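/- arXiv:2302.02085 — 2 statements merged into one kernel-verified Lean document; each statement's English description precedes it below -/
import Mathlib

section
/- Let A be a finite-dimensional algebra over an algebraically closed field K and Z an irreducible component of mod(A,d). Then the codimension in Z × Z of the set {(M,M') ∈ Z × Z | M ≅ M'} equals c(Z) := min{dim Z − dim O_M | M ∈ Z}, the number of parameters of Z. -/
open TopologicalSpace Topology CategoryTheory

/-- The Zariski topology on a `K`-vector space `W`: the initial topology with
respect to all polynomial functions `W → K` (the `K`-subalgebra of functions
generated by the linear functionals), where `K` carries the cofinite topology
(the Zariski topology of the affine line over an algebraically closed field). -/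
noncomputable def zariskiTopology (K W : Type*) [Field K] [AddCommGroup W] [Module K W] :
    TopologicalSpace W :=
  ⨅ f ∈ (Algebra.adjoin K (Set.range fun (φ : Module.Dual K W) => (φ : W → K)) :
      Subalgebra K (W → K)),
    TopologicalSpace.induced (fun w => CofiniteTopology.of (f w)) inferInstance

variable (K A : Type) [Field K] [Ring A] [Algebra K A]

/-- The variety `mod(A,d)` of `d`-dimensional `A`-module structures: the set of
`K`-algebra homomorphisms `A → M_d(K)`. -/
abbrev ModVar (d : ℕ) := A →ₐ[K] Matrix (Fin d) (Fin d) K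

/-- `mod(A,d)` carries the (subspace) Zariski topology, induced from the
Zariski topology of the affine space of linear maps `A → M_d(K)`. -/
noncomputable instance (d : ℕ) : TopologicalSpace (ModVar K A d) :=
  TopologicalSpace.induced (fun M : ModVar K A d => M.toLinearMap)
    (zariskiTopology K (A →ₗ[K] Matrix (Fin d) (Fin d) K))

/-- The `GL_d(K)`-orbit of a point of `mod(A,d)` under the conjugation action:
the set of module structures isomorphic to `M`. -/
def orbitSet {d : ℕ} (M : ModVar K A d) : Set (ModVar K A d) :=
  {M' | ∃ g : (Matrix (Fin d) (Fin d) K)ˣ,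
    ∀ a : A, M' a = (↑g⁻¹ : Matrix (Fin d) (Fin d) K) * M a * (↑g : Matrix (Fin d) (Fin d) K)}

/-- The space `Hom_A(M, M')` of `A`-module homomorphisms between the module
structures corresponding to points `M ∈ mod(A,d)`, `M' ∈ mod(A,d')`: the
`K`-linear maps intertwining the two actions. -/
def homSpace {d d' : ℕ} (M : ModVar K A d) (M' : ModVar K A d') :
    Submodule K ((Fin d → K) →ₗ[K] (Fin d' → K)) where
  carrier := {f | ∀ a : A,
    f.comp (Matrix.mulVecLin (M a)) = (Matrix.mulVecLin (M' a)).comp f}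
  add_mem' := by
    intro f g hf hg
    intro a
    simp only [Set.mem_setOf_eq] at hf hg
    rw [LinearMap.add_comp, LinearMap.comp_add, hf a, hg a]
  zero_mem' := by
    intro a
    rw [LinearMap.zero_comp, LinearMap.comp_zero]
  smul_mem' := by
    intro c f hf
    intro a
    simp only [Set.mem_setOf_eq] at hf
    rw [LinearMap.smul_comp, LinearMap.comp_smul, hf a]

/-- The Zariski topology on the product variety `mod(A,d) × mod(A,d')`. -/
noncomputable def prodZariski (d d' : ℕ) :
    TopologicalSpace (ModVar K A d × ModVar K A d') :=
  TopologicalSpace.induced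
    (fun p : ModVar K A d × ModVar K A d' => (p.1.toLinearMap, p.2.toLinearMap))
    (zariskiTopology K
      ((A →ₗ[K] Matrix (Fin d) (Fin d) K) × (A →ₗ[K] Matrix (Fin d') (Fin d') K)))

namespace MV

theorem krull_integral {R S : Type*} [CommRing R] [CommRing S] [Algebra R S]
    [Algebra.IsIntegral R S] (hinj : Function.Injective (algebraMap R S)) :
    ringKrullDim S = ringKrullDim R := by
  apply le_antisymm
  · refine Order.krullDim_le_of_strictMono (PrimeSpectrum.comap (algebraMap R S)) ?_
    intro p q hpq
    exact Ideal.IsIntegral.comap_lt_comap (R := R) (show p.asIdeal < q.asIdeal from hpq)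
  · have : FaithfulSMul R S := (faithfulSMul_iff_algebraMap_injective R S).mpr hinj
    refine iSup_le fun l => ?_
    obtain ⟨Q, hQ⟩ := Ideal.nonempty_primesOver (S := S) l.head.asIdeal
    have := hQ.1
    have := hQ.2
    obtain ⟨L, hL, -, -⟩ := Ideal.exists_ltSeries_of_hasGoingUp (S := S) l Q
    rw [← hL]
    exact le_iSup (fun L : LTSeries (PrimeSpectrum S) => ((L.length : ℕ∞) : WithBot ℕ∞)) L

/-- existence of points -/
theorem exists_point {K D : Type*} [Field K] [IsAlgClosed K] [CommRing D] [Nontrivial D] [Algebra K D]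
    [Algebra.FiniteType K D] : Nonempty (D →ₐ[K] K) := by
  obtain ⟨m, hm⟩ := Ideal.exists_maximal D
  let : Field (D ⧸ m) := Ideal.Quotient.field m
  have : Algebra.FiniteType K (D ⧸ m) := inferInstance
  have : Module.Finite K (D ⧸ m) := finite_of_finite_type_of_isJacobsonRing _ _
  have hb := IsAlgClosed.algebraMap_bijective_of_isIntegral (k := K) (K := D ⧸ m)
  exact ⟨((AlgEquiv.ofBijective (Algebra.ofId K (D ⧸ m)) hb).symm : D ⧸ m →ₐ[K] K).comp
    (Ideal.Quotient.mkₐ K m)⟩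

/-- points avoiding things, on a prime -/
theorem exists_point_avoid {K D : Type*} [Field K] [IsAlgClosed K] [CommRing D] [Algebra K D]
    [Algebra.FiniteType K D] (P : Ideal D) [P.IsPrime] (f : D) (hf : f ∉ P) :
    ∃ χ : D →ₐ[K] K, (∀ x ∈ P, χ x = 0) ∧ χ f ≠ 0 := by
  let fb := Ideal.Quotient.mk P f
  have hfb : fb ≠ 0 := fun h => hf (Ideal.Quotient.eq_zero_iff_mem.mp h)
  let L := Localization.Away fb
  have hn : Nontrivial L := by
    have : fb ∈ nonZeroDivisors (D ⧸ P) := mem_nonZeroDivisors_of_ne_zero hfb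
    have hle : Submonoid.powers fb ≤ nonZeroDivisors (D ⧸ P) := (Submonoid.powers_le).mpr this
    exact (IsLocalization.injective L hle).nontrivial
  have : Algebra.FiniteType (D ⧸ P) L := IsLocalization.finiteType_of_monoid_fg (Submonoid.powers fb) L
  have : Algebra.FiniteType K L := Algebra.FiniteType.trans (S := D ⧸ P) inferInstance inferInstance
  obtain ⟨χ⟩ := exists_point (K := K) (D := L)
  refine ⟨(χ.comp (IsScalarTower.toAlgHom K (D ⧸ P) L)).comp (Ideal.Quotient.mkₐ K P), ?_, ?_⟩
  · intro x hx
    have : Ideal.Quotient.mk P x = 0 := Ideal.Quotient.eq_zero_iff_mem.mpr hx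
    simp [this]
  · have hu : IsUnit (algebraMap (D ⧸ P) L fb) := IsLocalization.Away.algebraMap_isUnit fb
    exact (hu.map χ).ne_zero

theorem krull_eq_trdeg (K D : Type*) [Field K] [CommRing D] [IsDomain D] [Algebra K D]
    [Algebra.FiniteType K D] : ∃ n : ℕ, Algebra.trdeg K D = n ∧ ringKrullDim D = n := by
  obtain ⟨s, g, hg, hint⟩ := exists_integral_inj_algHom_of_fg K D
  refine ⟨s, ?_, ?_⟩
  · let := g.toRingHom.toAlgebra
    have : Algebra.IsIntegral (MvPolynomial (Fin s) K) D := ⟨hint⟩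
    have : FaithfulSMul (MvPolynomial (Fin s) K) D :=
      (faithfulSMul_iff_algebraMap_injective _ D).mpr hg
    have : IsScalarTower K (MvPolynomial (Fin s) K) D :=
      IsScalarTower.of_algebraMap_eq fun x => (g.commutes x).symm
    have h := _root_.lift_trdeg_add_eq K (MvPolynomial (Fin s) K) D
    simp [_root_.trdeg_eq_zero] at h
    simpa using h.symm
  · let := g.toRingHom.toAlgebra
    have : Algebra.IsIntegral (MvPolynomial (Fin s) K) D := ⟨hint⟩
    rw [krull_integral (R := MvPolynomial (Fin s) K) hg]
    simp

theorem extend_points {K D B : Type*} [Field K] [IsAlgClosed K] [CommRing D] [IsDomain D] [Algebra K D]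
    [CommRing B] [IsDomain B] [Algebra K B] [Algebra.FiniteType K D] [Algebra.FiniteType K B]
    (ι : D →ₐ[K] B) (hι : Function.Injective ι) :
    ∃ f : D, f ≠ 0 ∧ ∀ χ : D →ₐ[K] K, χ f ≠ 0 → ∃ χ' : B →ₐ[K] K, χ'.comp ι = χ := by
  have hfp : ι.toRingHom.FinitePresentation := by
    have : IsNoetherianRing D := Algebra.FiniteType.isNoetherianRing K D
    refine RingHom.FinitePresentation.of_finiteType.mp ?_
    refine RingHom.FiniteType.of_comp_finiteType (f := algebraMap K D) ?_
    rw [AlgHom.toRingHom_eq_coe, AlgHom.comp_algebraMap]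
    exact RingHom.finiteType_algebraMap.mpr inferInstance
  have hc := PrimeSpectrum.isConstructible_comap_image hfp (s := Set.univ) .univ
  obtain ⟨C, hC⟩ := PrimeSpectrum.exists_constructibleSetData_iff.mpr hc
  have hbot : (⊥ : PrimeSpectrum D) ∈ C.toSet := by
    rw [hC]
    refine ⟨⊥, trivial, ?_⟩
    ext x
    simp [PrimeSpectrum.asIdeal_bot, map_eq_zero_iff _ hι]
  simp only [PrimeSpectrum.ConstructibleSetData.toSet, Set.mem_iUnion] at hbot
  obtain ⟨c, hcC, hcb⟩ := hbot
  obtain ⟨h1, h2⟩ := hcb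
  refine ⟨c.f, ?_, ?_⟩
  · intro h
    apply h2
    simp [h]
  · intro χ hχ
    let p : PrimeSpectrum D := ⟨RingHom.ker χ, RingHom.ker_isPrime _⟩
    have hp : p ∈ PrimeSpectrum.comap ι.toRingHom '' Set.univ := by
      rw [← hC]
      simp only [PrimeSpectrum.ConstructibleSetData.toSet, Set.mem_iUnion]
      refine ⟨c, hcC, ?_, ?_⟩
      · intro x hx
        have := h1 hx
        simp [PrimeSpectrum.asIdeal_bot] at this
        simp [this]
      · intro h
        apply hχ
        simpa [p, RingHom.mem_ker] using h
    obtain ⟨q, -, hq⟩ := hp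
    have hq' : ∀ x, χ x = 0 ↔ ι x ∈ q.asIdeal := by
      intro x
      have := congrArg (fun r => x ∈ r.asIdeal) hq
      simp [p, RingHom.mem_ker] at this
      exact this.symm
    obtain ⟨χ', h0, -⟩ := exists_point_avoid (K := K) q.asIdeal 1
      (fun h => q.2.ne_top ((Ideal.eq_top_iff_one _).mpr h))
    refine ⟨χ', ?_⟩
    ext x
    have h3 : χ (x - algebraMap K D (χ x)) = 0 := by simp
    have h4 := h0 _ ((hq' _).mp h3)
    simp [sub_eq_zero] at h4
    simpa using h4
end MV

namespace MV

theorem krull_away (K D : Type*) [Field K] [CommRing D] [IsDomain D] [Algebra K D]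
    [Algebra.FiniteType K D] (f : D) (hf : f ≠ 0) :
    ringKrullDim (Localization.Away f) = ringKrullDim D := by
  let L := Localization.Away f
  have hle : Submonoid.powers f ≤ nonZeroDivisors D :=
    (Submonoid.powers_le).mpr (mem_nonZeroDivisors_of_ne_zero hf)
  have : IsDomain L := IsLocalization.isDomain_localization hle
  have : Algebra.FiniteType D L := IsLocalization.finiteType_of_monoid_fg (Submonoid.powers f) L
  have : Algebra.FiniteType K L := Algebra.FiniteType.trans (S := D) inferInstance inferInstance
  have : FaithfulSMul D L := (faithfulSMul_iff_algebraMap_injective _ L).mpr (IsLocalization.injective L hle)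
  have : Algebra.IsAlgebraic D L := IsLocalization.isAlgebraic L (Submonoid.powers f)
  have h := _root_.trdeg_add_eq K D (A := L)
  rw [_root_.trdeg_eq_zero (R := D) (A := L), add_zero] at h
  obtain ⟨m, hm, hm'⟩ := krull_eq_trdeg K L
  obtain ⟨k, hk, hk'⟩ := krull_eq_trdeg K D
  rw [hm', hk']
  rw [hm, hk] at h
  have : m = k := by exact_mod_cast h.symm
  rw [this]

section zt
variable {K X Y : Type} [Field K]

@[reducible] noncomputable def zt (O : Subalgebra K (X → K)) : TopologicalSpace X :=
  ⨅ f ∈ O, TopologicalSpace.induced (fun w => CofiniteTopology.of (f w)) inferInstance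

/-- precomposition -/
def pre (K : Type) [Field K] (φ : Y → X) : (X → K) →ₐ[K] (Y → K) :=
  AlgHom.pi (fun y => Pi.evalAlgHom K (fun _ : X => K) (φ y))

@[simp] theorem pre_apply (φ : Y → X) (f : X → K) (y : Y) : pre K φ f y = f (φ y) := rfl

theorem induced_zt (φ : Y → X) (O : Subalgebra K (X → K)) :
    TopologicalSpace.induced φ (zt O) = zt (O.map (pre K φ)) := by
  simp only [zt, induced_iInf, induced_compose]
  apply le_antisymm
  · refine le_iInf₂ fun f hf => ?_
    obtain ⟨g, hg, rfl⟩ := hf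
    exact iInf₂_le g hg
  · refine le_iInf₂ fun f hf => ?_
    exact iInf₂_le (pre K φ f) ⟨f, hf, rfl⟩

theorem isClosed_zt (O : Subalgebra K (X → K)) (f : X → K) (hf : f ∈ O) :
    IsClosed[zt O] {x | f x = 0} := by
  have h1 : IsClosed (X := CofiniteTopology K) {CofiniteTopology.of (0 : K)} := by
    rw [CofiniteTopology.isClosed_iff]
    right; exact Set.finite_singleton _
  have h2 : @Continuous X _ (zt O) _ (fun w => CofiniteTopology.of (f w)) := by
    rw [continuous_iff_le_induced]
    exact iInf₂_le f hf
  have h3 := @IsClosed.preimage _ _ (zt O) _ _ h2 _ h1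
  convert h3 using 1
  ext x
  simp

theorem isBasis_zt (O : Subalgebra K (X → K)) :
    @IsTopologicalBasis X (zt O) {U | ∃ f ∈ O, U = {x | f x ≠ 0}} := by
  let t := zt O
  refine @IsTopologicalBasis.mk X (zt O) _ ?_ ?_ ?_
  · rintro _ ⟨f, hf, rfl⟩ _ ⟨g, hg, rfl⟩ x hx
    refine ⟨_, ⟨f * g, O.mul_mem hf hg, rfl⟩, ?_, ?_⟩
    · exact mul_ne_zero hx.1 hx.2
    · intro y hy
      exact ⟨left_ne_zero_of_mul hy, right_ne_zero_of_mul hy⟩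
  · refine Set.eq_univ_of_univ_subset ?_
    intro x _
    exact ⟨Set.univ, ⟨1, O.one_mem, by simp⟩, trivial⟩
  · apply le_antisymm
    · refine le_generateFrom ?_
      rintro _ ⟨f, hf, rfl⟩
      exact (isClosed_zt O f hf).isOpen_compl
    · refine le_iInf₂ fun f hf => ?_
      rw [← continuous_iff_le_induced]
      refine @Continuous.mk _ _ (_) _ _ ?_
      intro U hU
      rcases U.eq_empty_or_nonempty with rfl | hne
      · simp
      · have hfin := CofiniteTopology.isOpen_iff'.mp hU
        have hfin : Uᶜ.Finite := by
          rcases hfin with h | h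
          · exact absurd h hne.ne_empty
          · exact h
        refine TopologicalSpace.isOpen_generateFrom_of_mem ?_
        refine ⟨∏ c ∈ hfin.toFinset, (f - algebraMap K _ (CofiniteTopology.of.symm c)), ?_, ?_⟩
        · exact O.prod_mem fun c _ => O.sub_mem hf (O.algebraMap_mem _)
        · ext x
          simp only [Set.mem_preimage, Finset.prod_apply, ne_eq, Finset.prod_eq_zero_iff, Set.mem_ofPred_eq,
            Set.Finite.mem_toFinset, Set.mem_compl_iff, not_exists, not_and]
          constructor
          · intro hx c hc h0
            apply hc
            have : f x = CofiniteTopology.of.symm c := by simpa [sub_eq_zero] using h0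
            rw [this] at hx
            simpa using hx
          · intro h
            by_contra hx
            exact h _ hx (by simp)

theorem exists_sep (O : Subalgebra K (X → K)) (C : Set X) (hC : IsClosed[zt O] C) (x : X) (hx : x ∉ C) :
    ∃ f ∈ O, (∀ y ∈ C, f y = 0) ∧ f x ≠ 0 := by
  let t := zt O
  obtain ⟨_, ⟨f, hf, rfl⟩, h1, h2⟩ := (isBasis_zt O).exists_subset_of_mem_open
    (show x ∈ Cᶜ from hx) hC.isOpen_compl
  refine ⟨f, hf, ?_, h1⟩
  intro y hy
  by_contra h
  exact h2 h hy

/-- vanishing ideal in `O` -/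
def vid (O : Subalgebra K (X → K)) (C : Set X) : Ideal O where
  carrier := {f | ∀ x ∈ C, f.1 x = 0}
  add_mem' := fun ha hb x hx => by simp [ha x hx, hb x hx]
  zero_mem' := fun x _ => rfl
  smul_mem' := fun c f hf x hx => by simp [hf x hx]

theorem mem_vid (O : Subalgebra K (X → K)) (C : Set X) (f : O) :
  f ∈ vid O C ↔ ∀ x ∈ C, f.1 x = 0 := Iff.rfl

theorem vid_prime (O : Subalgebra K (X → K)) (C : Set X)
    (hC : @IsIrreducible X (zt O) C) : (vid O C).IsPrime := by
  let t := zt O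
  constructor
  · intro h
    obtain ⟨x, hx⟩ := hC.1
    have : (1 : O) ∈ vid O C := by rw [h]; trivial
    simpa using this x hx
  · intro f g hfg
    by_contra hcon
    push Not at hcon
    simp only [mem_vid, not_forall] at hcon
    obtain ⟨⟨x, hx, hfx⟩, ⟨y, hy, hgy⟩⟩ := hcon
    obtain ⟨z, hz, hz1, hz2⟩ := hC.2 {x | f.1 x = 0}ᶜ {x | g.1 x = 0}ᶜ (isClosed_zt O f.1 f.2).isOpen_compl
      (isClosed_zt O g.1 g.2).isOpen_compl ⟨x, hx, hfx⟩ ⟨y, hy, hgy⟩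
    have := hfg z hz
    simp at this
    exact this.elim hz1 hz2

theorem irred_of_vid_prime (O : Subalgebra K (X → K)) (C : Set X)
    (hP : (vid O C).IsPrime) : @IsIrreducible X (zt O) C := by
  let t := zt O
  constructor
  · by_contra h
    rw [Set.not_nonempty_iff_eq_empty] at h
    apply hP.ne_top
    rw [Ideal.eq_top_iff_one]
    intro x hx
    simp [h] at hx
  · rintro U V hU hV ⟨x, hx, hxU⟩ ⟨y, hy, hyV⟩
    by_contra hcon
    obtain ⟨f, hf, hf1, hf2⟩ := exists_sep O Uᶜ hU.isClosed_compl x (by simpa)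
    obtain ⟨g, hg, hg1, hg2⟩ := exists_sep O Vᶜ hV.isClosed_compl y (by simpa)
    have : (⟨f, hf⟩ * ⟨g, hg⟩ : O) ∈ vid O C := by
      intro z hz
      by_contra h0
      have h0 : f z * g z ≠ 0 := h0
      apply hcon
      refine ⟨z, hz, ?_, ?_⟩
      · by_contra h; exact left_ne_zero_of_mul h0 (hf1 z h)
      · by_contra h; exact right_ne_zero_of_mul h0 (hg1 z h)
    rcases hP.mem_or_mem this with h | h
    · exact hf2 (h x hx)
    · exact hg2 (h y hy)

theorem krull_le (O : Subalgebra K (X → K)) :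
    @topologicalKrullDim X (zt O) ≤ ringKrullDim O := by
  let t := zt O
  rw [topologicalKrullDim, ringKrullDim, ← Order.krullDim_orderDual (α := PrimeSpectrum O)]
  refine Order.krullDim_le_of_strictMono
    (fun C : IrreducibleCloseds X => OrderDual.toDual (⟨vid O C, vid_prime O C C.2⟩ : PrimeSpectrum O)) ?_
  intro C C' h
  have h1 : (C : Set X) ⊂ C' := h
  change vid O C' < vid O C
  refine lt_of_le_of_ne (fun f hf x hx => hf x (h1.1 hx)) ?_
  intro heq
  obtain ⟨x, hx, hx'⟩ := Set.exists_of_ssubset h1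
  obtain ⟨f, hf, h2, h3⟩ := exists_sep O C C.3 x hx'
  have : (⟨f, hf⟩ : O) ∈ vid O C := h2
  rw [← heq] at this
  exact h3 (this x hx)

theorem krull_ge [IsAlgClosed K] (O : Subalgebra K (X → K)) [Algebra.FiniteType K O] (f : O)
    (hpt : ∀ χ : O →ₐ[K] K, χ f ≠ 0 → ∃ x : X, ∀ g : O, χ g = g.1 x) :
    ringKrullDim (Localization.Away f) ≤ @topologicalKrullDim X (zt O) := by
  let t := zt O
  let zl : Ideal O → Set X := fun P => {x | ∀ g ∈ P, g.1 x = 0}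
  have hzc : ∀ P, IsClosed (zl P) := by
    intro P
    have : zl P = ⋂ g ∈ P, {x | g.1 x = 0} := by ext; simp [zl]
    rw [this]
    exact isClosed_biInter fun g _ => isClosed_zt O g.1 g.2
  have hvz : ∀ P : Ideal O, P.IsPrime → f ∉ P → vid O (zl P) = P := by
    intro P hP hf
    apply le_antisymm
    · intro g hg
      by_contra hgP
      obtain ⟨χ, h1, h2⟩ := exists_point_avoid (K := K) P (f * g) (fun h => (hP.mem_or_mem h).elim hf hgP)
      rw [map_mul] at h2
      obtain ⟨x, hx⟩ := hpt χ (left_ne_zero_of_mul h2)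
      apply right_ne_zero_of_mul h2
      rw [hx]
      exact hg x fun g' hg' => by rw [← hx, h1 g' hg']
    · intro g hg x hx
      exact hx g hg
  have hcomap : ∀ p : PrimeSpectrum (Localization.Away f),
      f ∉ (PrimeSpectrum.comap (algebraMap O (Localization.Away f)) p).asIdeal := by
    intro p hp
    have hu : IsUnit (algebraMap O (Localization.Away f) f) := IsLocalization.Away.algebraMap_isUnit f
    exact p.2.ne_top (Ideal.eq_top_of_isUnit_mem _ hp hu)
  let F : PrimeSpectrum (Localization.Away f) → (IrreducibleCloseds X)ᵒᵈ := fun p =>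
    OrderDual.toDual ⟨zl (PrimeSpectrum.comap (algebraMap O (Localization.Away f)) p).asIdeal,
      irred_of_vid_prime O _ (by
        rw [hvz _ (PrimeSpectrum.comap (algebraMap O (Localization.Away f)) p).2 (hcomap p)]
        exact (PrimeSpectrum.comap (algebraMap O (Localization.Away f)) p).2), hzc _⟩
  rw [topologicalKrullDim, ← Order.krullDim_orderDual (α := IrreducibleCloseds X)]
  refine Order.krullDim_le_of_strictMono F ?_
  intro p q hpq
  have hinj : Function.Injective (PrimeSpectrum.comap (algebraMap O (Localization.Away f))) :=
    PrimeSpectrum.localization_comap_injective _ (Submonoid.powers f)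
  have hle : (PrimeSpectrum.comap (algebraMap O (Localization.Away f)) p).asIdeal ≤
    (PrimeSpectrum.comap (algebraMap O (Localization.Away f)) q).asIdeal :=
      Ideal.comap_mono hpq.le
  refine lt_of_le_of_ne ?_ ?_
  · change zl _ ⊆ zl _
    intro x hx g hg
    exact hx g (hle hg)
  · intro heq
    apply hpq.ne
    apply hinj
    apply PrimeSpectrum.ext
    have h1 : zl (PrimeSpectrum.comap (algebraMap O (Localization.Away f)) p).asIdeal =
      zl (PrimeSpectrum.comap (algebraMap O (Localization.Away f)) q).asIdeal :=
      congrArg (fun C : (IrreducibleCloseds X)ᵒᵈ => ((OrderDual.ofDual C : IrreducibleCloseds X) : Set X)) heq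
    rw [← hvz _ (PrimeSpectrum.comap (algebraMap O (Localization.Away f)) p).2 (hcomap p),
      ← hvz _ (PrimeSpectrum.comap (algebraMap O (Localization.Away f)) q).2 (hcomap q), h1]

theorem krull_closed [IsAlgClosed K] (O : Subalgebra K (X → K)) [Algebra.FiniteType K O]
    (hpt : ∀ χ : O →ₐ[K] K, ∃ x : X, ∀ g : O, χ g = g.1 x) :
    @topologicalKrullDim X (zt O) = ringKrullDim O := by
  refine le_antisymm (krull_le O) ?_
  refine le_trans (le_of_eq ?_) (krull_ge O 1 (fun χ _ => hpt χ))
  exact ringKrullDim_eq_of_ringEquiv (IsLocalization.atOne O (Localization.Away (1 : O))).toRingEquiv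

theorem krull_dominant [IsAlgClosed K] (O : Subalgebra K (X → K)) [Algebra.FiniteType K O] [IsDomain O]
    (f : O) (hf : f ≠ 0)
    (hpt : ∀ χ : O →ₐ[K] K, χ f ≠ 0 → ∃ x : X, ∀ g : O, χ g = g.1 x) (n : ℕ) (hn : Algebra.trdeg K O = n) :
    @topologicalKrullDim X (zt O) = n := by
  obtain ⟨k, hk, hk'⟩ := krull_eq_trdeg K O
  have e2 : k = n := by rw [hn] at hk; exact_mod_cast hk.symm
  subst e2
  refine le_antisymm ?_ ?_
  · rw [← hk']; exact krull_le O
  · rw [← hk', ← krull_away K O f hf]; exact krull_ge O f hpt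
end zt
end MV

namespace MV
section thmA
open IntermediateField.algebraAdjoinAdjoin

theorem trdeg_adjoin_eq (F L : Type) [Field F] [Field L] [Algebra F L] (S : Set L) :
    Algebra.trdeg F (IntermediateField.adjoin F S) = Algebra.trdeg F (Algebra.adjoin F S) := by
  have h := _root_.trdeg_add_eq F (Algebra.adjoin F S) (A := IntermediateField.adjoin F S)
  rw [_root_.trdeg_eq_zero (R := Algebra.adjoin F S) (A := IntermediateField.adjoin F S), add_zero] at h
  exact h.symm

theorem trdeg_adjoin_le (F L : Type) [Field F] [Field L] [Algebra F L] (S : Set L) :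
    Algebra.trdeg F (IntermediateField.adjoin F S) ≤ Cardinal.mk S := by
  rw [trdeg_adjoin_eq]
  have hr : (MvPolynomial.aeval (R := F) (Subtype.val : S → L)).range = Algebra.adjoin F S := by
    rw [← Algebra.adjoin_range_eq_range_aeval, Subtype.range_coe]
  rw [← hr]
  refine (_root_.trdeg_le_of_surjective _
    (AlgHom.rangeRestrict_surjective (MvPolynomial.aeval (R := F) (Subtype.val : S → L)))).trans ?_
  rw [MvPolynomial.trdeg_of_isDomain]
  simp

theorem trdeg_le_of_adjoin_top (F L : Type) [Field F] [Field L] [Algebra F L] (S : Set L)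
    (h : IntermediateField.adjoin F S = ⊤) : Algebra.trdeg F L ≤ Cardinal.mk S := by
  have := trdeg_adjoin_le F L S
  rw [h] at this
  rwa [(IntermediateField.topEquiv (F := F) (E := L)).trdeg_eq] at this

variable {F L n ι : Type} [Field F] [Field L] [Algebra F L] [Fintype n] [DecidableEq n]

/-- intertwining matrices -/
def hs {F : Type} [Field F] (M N : ι → Matrix n n F) : Submodule F (Matrix n n F) where
  carrier := {h | ∀ a, M a * h = h * N a}
  add_mem' := fun ha hb a => by simp [mul_add, add_mul, ha a, hb a]
  zero_mem' := fun a => by simp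
  smul_mem' := fun c h hh a => by simp [hh a]

theorem mem_hs {F : Type} [Field F] (M N : ι → Matrix n n F) (h) :
  h ∈ hs M N ↔ ∀ a, M a * h = h * N a := Iff.rfl

theorem map_li {κ : Type} (v : κ → Matrix n n F) (hv : LinearIndependent F v) :
    LinearIndependent L (fun k => (v k).map (algebraMap F L)) := by
  let b := Module.Free.chooseBasis F L
  rw [linearIndependent_iff'] at hv ⊢
  intro s c hc k hk
  rw [← b.forall_coord_eq_zero_iff]
  intro m
  refine hv s (fun k => b.coord m (c k)) ?_ k hk
  ext i j
  have := congrArg (b.coord m) (congrFun (congrFun hc i) j)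
  simp only [Matrix.sum_apply, Matrix.smul_apply, Matrix.map_apply, smul_eq_mul, map_sum, Matrix.zero_apply, map_zero] at this ⊢
  rw [← this]
  refine Finset.sum_congr rfl fun k _ => ?_
  rw [mul_comm (c k), ← Algebra.smul_def, map_smul, smul_eq_mul, mul_comm]

theorem descent (M N : ι → Matrix n n F) (x : Matrix n n L)
    (hx : x ∈ hs (fun a => (M a).map (algebraMap F L)) (fun a => (N a).map (algebraMap F L))) :
    x ∈ Submodule.span L ((fun h => h.map (algebraMap F L)) '' (hs M N : Set (Matrix n n F))) := by
  classical
  let b := Module.Free.chooseBasis F L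
  let s := Finset.univ.biUnion fun i : n => Finset.univ.biUnion fun j : n => (b.repr (x i j)).support
  have e : x = ∑ m ∈ s, b m • (x.map (b.coord m)).map (algebraMap F L) := by
    ext i j
    simp only [Matrix.sum_apply, Matrix.smul_apply, Matrix.map_apply, smul_eq_mul]
    conv_lhs => rw [← b.linearCombination_repr (x i j)]
    rw [Finsupp.linearCombination_apply, Finsupp.sum_of_support_subset (s := s)]
    · refine Finset.sum_congr rfl fun m _ => ?_
      rw [Algebra.smul_def, mul_comm]; rfl
    · intro m hm
      simp only [s, Finset.mem_biUnion, Finset.mem_univ, true_and]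
      exact ⟨i, j, hm⟩
    · simp
  rw [e]
  refine Submodule.sum_mem _ fun m _ => Submodule.smul_mem _ _ (Submodule.subset_span ⟨_, ?_, rfl⟩)
  intro a
  ext i j
  have := congrArg (b.coord m) (congrFun (congrFun (hx a) i) j)
  simp only [Matrix.mul_apply, Matrix.map_apply, map_sum] at this ⊢
  convert this using 1
  · refine Finset.sum_congr rfl fun k _ => ?_
    rw [← Algebra.smul_def, map_smul, smul_eq_mul]
  · refine Finset.sum_congr rfl fun k _ => ?_
    rw [mul_comm (x i k), ← Algebra.smul_def, map_smul, smul_eq_mul, mul_comm]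

theorem map_mem_hs (M N : ι → Matrix n n F) (h) (hh : h ∈ hs M N) :
    h.map (algebraMap F L) ∈ hs (fun a => (M a).map (algebraMap F L)) (fun a => (N a).map (algebraMap F L)) := by
  intro a
  simp only [← Matrix.map_mul, hh a]

theorem hs_map_eq_span {κ : Type} [Fintype κ] (M N : ι → Matrix n n F) (b : Module.Basis κ F (hs M N)) :
    hs (fun a => (M a).map (algebraMap F L)) (fun a => (N a).map (algebraMap F L)) =
      Submodule.span L (Set.range fun k => (b k : Matrix n n F).map (algebraMap F L)) := by
  apply le_antisymm
  · intro x hx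
    refine Submodule.span_le.mpr ?_ (descent M N x hx)
    rintro _ ⟨h, hh, rfl⟩
    have h2 : h = ∑ i, b.repr ⟨h, hh⟩ i • (b i : Matrix n n F) := by
      have := congrArg (hs M N).subtype (b.sum_repr ⟨h, hh⟩)
      rw [map_sum] at this
      simp only [map_smul, Submodule.subtype_apply] at this
      exact this.symm
    generalize b.repr ⟨h, hh⟩ = c at h2
    have h3 : h.map (algebraMap F L) = ∑ i, (algebraMap F L (c i)) • (b i : Matrix n n F).map (algebraMap F L) := by
      rw [h2]
      ext i j
      simp only [Matrix.sum_apply, Matrix.map_apply, Matrix.smul_apply, map_sum, smul_eq_mul, map_mul]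
    change h.map (algebraMap F L) ∈ _
    rw [h3]
    exact Submodule.sum_mem _ fun i _ => Submodule.smul_mem _ _ (Submodule.subset_span ⟨i, rfl⟩)
  · rw [Submodule.span_le]
    rintro _ ⟨k, rfl⟩
    exact map_mem_hs M N _ (b k).2

theorem finrank_hs_map (M N : ι → Matrix n n F) :
    Module.finrank L (hs (fun a => (M a).map (algebraMap F L)) (fun a => (N a).map (algebraMap F L)))
      = Module.finrank F (hs M N) := by
  let b := Module.finBasis F (hs M N)
  have hli := map_li (L := L) (fun k => (b k : Matrix n n F))
    (b.linearIndependent.map' (hs M N).subtype (Submodule.ker_subtype _))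
  rw [hs_map_eq_span M N b, finrank_span_eq_card hli]
  simp

theorem finrank_hs_conj (M N : ι → Matrix n n L) (g gi : Matrix n n L) (hg : gi * g = 1)
    (hN : ∀ a, N a = gi * M a * g) :
    Module.finrank L (hs M N) = Module.finrank L (hs M M) := by
  have hg' : g * gi = 1 := mul_eq_one_comm.mp hg
  refine LinearEquiv.finrank_eq
    { toFun := fun h => ⟨h.1 * gi, fun a => ?_⟩
      invFun := fun h => ⟨h.1 * g, fun a => ?_⟩
      map_add' := fun x y => by ext1; simp [add_mul]
      map_smul' := fun c x => by ext1; simp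
      left_inv := fun x => by ext1; simp [mul_assoc, hg]
      right_inv := fun x => by ext1; simp [mul_assoc, hg'] }
  · rw [← mul_assoc, h.2 a, hN]
    simp only [mul_assoc, hg', mul_one]
  · rw [← mul_assoc, h.2 a, hN]
    simp only [mul_assoc]
    rw [← mul_assoc g gi, hg', one_mul]

theorem lower (M : ι → Matrix n n F) (g gi : Matrix n n L) (hg : gi * g = 1)
    (htop : IntermediateField.adjoin F (Set.range fun p : n × n => g p.1 p.2) = ⊤)
    (E : IntermediateField F L)
    (hE : E = IntermediateField.adjoin F (Set.range fun p : ι × n × n => (gi * (M p.1).map (algebraMap F L) * g) p.2.1 p.2.2)) :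
    Algebra.trdeg F L ≤ Algebra.trdeg F E + (Module.finrank F (hs M M) : ℕ) := by
  rw [← _root_.trdeg_add_eq F E (A := L)]
  gcongr
  have hmem : ∀ a i j, (gi * (M a).map (algebraMap F L) * g) i j ∈ E := fun a i j => by
    rw [hE]; exact IntermediateField.subset_adjoin _ _ ⟨(a, i, j), rfl⟩
  let N : ι → Matrix n n E := fun a => Matrix.of fun i j => ⟨_, hmem a i j⟩
  let ME : ι → Matrix n n E := fun a => (M a).map (algebraMap F E)
  have hME : (fun a => (ME a).map (algebraMap E L)) = fun a => (M a).map (algebraMap F L) := by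
    ext a i j; rfl
  have hNE : (fun a => (N a).map (algebraMap E L)) = fun a => gi * (M a).map (algebraMap F L) * g := by
    ext a i j; rfl
  have e1 : Module.finrank E (hs ME N) = Module.finrank F (hs M M) := by
    rw [← finrank_hs_map (L := L) ME N, hME, hNE, finrank_hs_conj _ _ g gi hg (fun a => rfl), finrank_hs_map]
  have hg' : g * gi = 1 := mul_eq_one_comm.mp hg
  have hgm : g ∈ hs (fun a => (ME a).map (algebraMap E L)) (fun a => (N a).map (algebraMap E L)) := by
    rw [hME, hNE]
    intro a
    simp only [← mul_assoc, hg', one_mul]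
  let b := Module.finBasis E (hs ME N)
  rw [← e1]
  have h3 := hgm
  rw [hs_map_eq_span ME N b] at h3
  obtain ⟨t, ht⟩ := (Submodule.mem_span_range_iff_exists_fun L).mp h3
  refine (trdeg_le_of_adjoin_top E L (Set.range t) ?_).trans ?_
  · rw [← IntermediateField.restrictScalars_eq_top_iff (K := F), ← top_le_iff, ← htop, IntermediateField.adjoin_le_iff]
    rintro _ ⟨⟨i, j⟩, rfl⟩
    change g i j ∈ IntermediateField.adjoin E (Set.range t)
    rw [← ht]
    simp only [Matrix.sum_apply, Matrix.smul_apply, smul_eq_mul, Matrix.map_apply]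
    exact sum_mem fun k _ => mul_mem (IntermediateField.subset_adjoin _ _ ⟨k, rfl⟩) (IntermediateField.algebraMap_mem _ _)
  · refine Cardinal.mk_range_le.trans ?_
    simp
theorem coords {κ : Type} [Fintype κ] (V : Submodule L (κ → L)) :
    ∃ (J : Type) (_ : Fintype J) (a : J → κ), Function.Injective a ∧ Fintype.card J = Module.finrank L V ∧
      ∃ e : V ≃ₗ[L] (J → L), ∀ v r, e v r = v.1 (a r) := by
  classical
  let φ : κ → Module.Dual L V := fun k => (LinearMap.proj k).comp V.subtype
  obtain ⟨J, a, ha, hsp, hli⟩ := exists_linearIndependent' L φ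
  have : Fintype J := Fintype.ofInjective a ha
  let T : V →ₗ[L] (J → L) := LinearMap.pi fun r => φ (a r)
  have hinj : Function.Injective T := by
    rw [← LinearMap.ker_eq_bot, LinearMap.ker_eq_bot']
    intro v hv
    have h1 : ∀ ψ ∈ Submodule.span L (Set.range (φ ∘ a)), ψ v = 0 := by
      intro ψ hψ
      induction hψ using Submodule.span_induction with
      | mem x h => obtain ⟨r, rfl⟩ := h; exact congrFun hv r
      | zero => rfl
      | add x y _ _ hx hy => simp [hx, hy]
      | smul c x _ hx => simp [hx]
    rw [hsp] at h1
    ext k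
    exact h1 (φ k) (Submodule.subset_span ⟨k, rfl⟩)
  have hc1 : Fintype.card J ≤ Module.finrank L V := by
    have := hli.fintype_card_le_finrank
    rwa [Subspace.dual_finrank_eq] at this
  have hc2 : Module.finrank L V ≤ Fintype.card J := by
    have := LinearMap.finrank_le_finrank_of_injective hinj
    simpa using this
  have hc := le_antisymm hc1 hc2
  refine ⟨J, this, a, ha, hc, LinearEquiv.ofInjectiveOfFinrankEq T hinj (by simp [hc]), ?_⟩
  intro v r
  rfl

theorem exists_good [Infinite F] {J : Type} [Fintype J] (V : Submodule L (n × n → L)) (e : V ≃ₗ[L] (J → L))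
    (g : V) (hg : (Matrix.of fun i j => g.1 (i, j)).det ≠ 0) :
    ∃ c : J → F, (Matrix.of fun i j => (e.symm fun r => algebraMap F L (c r)).1 (i, j)).det ≠ 0 := by
  classical
  let y : J → V := fun r => e.symm (Pi.single r 1)
  let P : MvPolynomial J L := (Matrix.of fun i j => ∑ r, MvPolynomial.X r * MvPolynomial.C ((y r).1 (i, j))).det
  have hev : ∀ c : J → L, MvPolynomial.eval c P = (Matrix.of fun i j => (e.symm c).1 (i, j)).det := by
    intro c
    simp only [P]
    rw [RingHom.map_det]
    congr 1
    ext i j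
    have : c = ∑ r, c r • (Pi.single r 1 : J → L) := by
      ext k; simp [Finset.sum_apply, Pi.single_apply]
    conv_rhs => rw [this, map_sum]
    simp [y, Finset.sum_apply]
  by_contra hcon
  push Not at hcon
  have hP : P = 0 := by
    refine MvPolynomial.funext_set (fun _ => Set.range (algebraMap F L))
      (fun _ => Set.infinite_range_of_injective (algebraMap F L).injective) ?_
    intro x hx
    have hx : ∀ i, ∃ c, algebraMap F L c = x i := fun i => hx i trivial
    choose c hc using hx
    have : x = fun r => algebraMap F L (c r) := by ext r; exact (hc r).symm
    rw [map_zero, hev, this, hcon c]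
  apply hg
  have := hev (e g)
  rw [hP, map_zero] at this
  simpa using this.symm

theorem upper [Infinite F] (M : ι → Matrix n n F) (g gi : Matrix n n L) (hg : gi * g = 1)
    (E : IntermediateField F L)
    (hE : E = IntermediateField.adjoin F (Set.range fun p : ι × n × n => (gi * (M p.1).map (algebraMap F L) * g) p.2.1 p.2.2)) :
    Algebra.trdeg F E + (Module.finrank F (hs M M) : ℕ) ≤ (Fintype.card (n × n) : ℕ) := by
  classical
  have hg' : g * gi = 1 := mul_eq_one_comm.mp hg
  let N : ι → Matrix n n L := fun a => gi * (M a).map (algebraMap F L) * g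
  let ML : ι → Matrix n n L := fun a => (M a).map (algebraMap F L)
  have hfr : Module.finrank L (hs ML N) = Module.finrank F (hs M M) := by
    rw [finrank_hs_conj ML N g gi hg (fun a => rfl), finrank_hs_map]
  let cu : Matrix n n L ≃ₗ[L] (n × n → L) :=
    { toFun := fun m p => m p.1 p.2
      invFun := fun v => Matrix.of fun i j => v (i, j)
      map_add' := fun _ _ => rfl
      map_smul' := fun _ _ => rfl
      left_inv := fun _ => rfl
      right_inv := fun _ => rfl }
  let V : Submodule L (n × n → L) := (hs ML N).map cu.toLinearMap
  have hV : Module.finrank L V = Module.finrank F (hs M M) := by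
    rw [← hfr]; exact cu.finrank_map_eq _
  have hgm : g ∈ hs ML N := by
    intro a
    simp only [N, ML, ← mul_assoc, hg', one_mul]
  obtain ⟨J, _, a, ha, hJ, e, he⟩ := coords V
  obtain ⟨c, hc⟩ := exists_good (F := F) V e ⟨cu g, g, hgm, rfl⟩ (by
    change g.det ≠ 0
    intro h0
    have := congrArg Matrix.det hg
    rw [Matrix.det_mul, h0, mul_zero, Matrix.det_one] at this
    exact zero_ne_one this)
  set v : V := e.symm fun r => algebraMap F L (c r) with hv
  obtain ⟨y, hy, hyv⟩ := v.2
  have hyv' : ∀ i j, y i j = v.1 (i, j) := fun i j => congrFun hyv (i, j)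
  have hy0 : y.det ≠ 0 := by
    convert hc using 2
    ext i j; exact hyv' i j
  let S : Set L := Set.range fun p : {p : n × n // p ∉ Set.range a} => v.1 p.1
  have hyE : ∀ i j, y i j ∈ IntermediateField.adjoin F S := by
    intro i j
    rw [hyv']
    by_cases h : (i, j) ∈ Set.range a
    · obtain ⟨r, hr⟩ := h
      rw [← hr, ← he, hv, LinearEquiv.apply_symm_apply]
      exact IntermediateField.algebraMap_mem _ _
    · exact IntermediateField.subset_adjoin _ _ ⟨⟨_, h⟩, rfl⟩
  have hEle : E ≤ IntermediateField.adjoin F S := by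
    rw [hE, IntermediateField.adjoin_le_iff]
    rintro _ ⟨⟨b, i, j⟩, rfl⟩
    change N b i j ∈ IntermediateField.adjoin F S
    let y' : Matrix n n (IntermediateField.adjoin F S) := Matrix.of fun i j => ⟨y i j, hyE i j⟩
    have hy' : y'.map (algebraMap _ L) = y := rfl
    have hu : IsUnit y'.det := by
      rw [isUnit_iff_ne_zero]
      intro h0
      apply hy0
      rw [← hy', ← RingHom.mapMatrix_apply, ← RingHom.map_det, h0, map_zero]
    have h1 : y'⁻¹.map (algebraMap _ L) * y = 1 := by
      rw [← hy', ← Matrix.map_mul, Matrix.nonsing_inv_mul _ hu]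
      exact Matrix.map_one _ (map_zero _) (map_one _)
    have h2 : N b = (y'⁻¹ * (M b).map (algebraMap F _) * y').map (algebraMap _ L) := by
      rw [Matrix.map_mul, Matrix.map_mul, hy']
      have : ((M b).map (algebraMap F (IntermediateField.adjoin F S))).map (algebraMap _ L) = ML b := rfl
      rw [this, mul_assoc, hy b, ← mul_assoc, h1, one_mul]
    rw [h2]
    exact ((y'⁻¹ * (M b).map (algebraMap F (IntermediateField.adjoin F S)) * y' :
      Matrix n n (IntermediateField.adjoin F S)) i j).2
  have h1 : Algebra.trdeg F E ≤ Cardinal.mk S :=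
    (_root_.trdeg_le_of_injective (IntermediateField.inclusion hEle)
      (IntermediateField.inclusion_injective hEle)).trans (trdeg_adjoin_le F L S)
  have h2 : Cardinal.mk S ≤ (Fintype.card {p : n × n // p ∉ Set.range a} : ℕ) := by
    refine Cardinal.mk_range_le.trans ?_
    simp
  have h3 : Fintype.card {p : n × n // p ∉ Set.range a} + Module.finrank F (hs M M) = Fintype.card (n × n) := by
    rw [← hV, ← hJ, Fintype.card_subtype_compl, ← Set.card_range_of_injective ha]
    refine Nat.sub_add_cancel ?_
    exact Fintype.card_subtype_le _
  rw [← h3, Nat.cast_add]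
  gcongr
  exact h1.trans h2

theorem thmA [Infinite F] (M : ι → Matrix n n F) (g gi : Matrix n n L) (hg : gi * g = 1)
    (hind : AlgebraicIndependent F (fun p : n × n => g p.1 p.2))
    (htop : IntermediateField.adjoin F (Set.range fun p : n × n => g p.1 p.2) = ⊤)
    (E : IntermediateField F L)
    (hE : E = IntermediateField.adjoin F (Set.range fun p : ι × n × n => (gi * (M p.1).map (algebraMap F L) * g) p.2.1 p.2.2)) :
    Algebra.trdeg F E + (Module.finrank F (hs M M) : ℕ) = (Fintype.card (n × n) : ℕ) := by
  refine le_antisymm (upper M g gi hg E hE) (le_trans ?_ (lower M g gi hg htop E hE))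
  have := hind.cardinalMk_le_trdeg
  simpa using this
end thmA
end MV

namespace MV
section ranks

theorem exists_minor {L p q : Type} [Field L] [Fintype p] [Fintype q] (T : Matrix p q L) :
    ∃ (f : Fin T.rank → p) (a : Fin T.rank → q), (T.submatrix f a).det ≠ 0 := by
  classical
  let V := Submodule.span L (Set.range T.row)
  have hr : T.rank = Module.finrank L V := T.rank_eq_finrank_span_row
  obtain ⟨J, _, a, ha, hJ, e, he⟩ := coords V
  obtain ⟨J', f, hf, hsp, hli⟩ := exists_linearIndependent' L T.row
  have : Fintype J' := Fintype.ofInjective f hf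
  have hJ' : Fintype.card J' = Module.finrank L V := by
    change _ = Module.finrank L (Submodule.span L (Set.range T.row))
    rw [← hsp, finrank_span_eq_card hli]
  let e1 : Fin T.rank ≃ J' := (Fintype.equivFinOfCardEq (hJ'.trans hr.symm)).symm
  let e2 : Fin T.rank ≃ J := (Fintype.equivFinOfCardEq (hJ.trans hr.symm)).symm
  refine ⟨f ∘ e1, a ∘ e2, ?_⟩
  rw [← isUnit_iff_ne_zero, ← Matrix.isUnit_iff_isUnit_det, ← Matrix.linearIndependent_rows_iff_isUnit]
  let w : J' → V := fun r => ⟨T.row (f r), Submodule.subset_span ⟨_, rfl⟩⟩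
  have hw : LinearIndependent L w := by
    refine LinearIndependent.of_comp V.subtype ?_
    exact hli
  let e3 : V ≃ₗ[L] (Fin T.rank → L) := e.trans (LinearEquiv.funCongrLeft L L e2)
  have h4 := (hw.map' e3.toLinearMap e3.ker).comp e1 e1.injective
  have h5 : ((e3.toLinearMap ∘ w) ∘ e1) = (T.submatrix (f ∘ e1) (a ∘ e2)).row := by
    ext i j
    simp [e3, LinearEquiv.funCongrLeft_apply, he, w, LinearMap.funLeft_apply, Matrix.row]
  rw [← h5]
  exact h4

theorem le_rank_of_minor {L p q : Type} [Field L] [Fintype p] [Fintype q] (T : Matrix p q L) (r : ℕ)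
    (f : Fin r → p) (a : Fin r → q) (h : (T.submatrix f a).det ≠ 0) : r ≤ T.rank := by
  classical
  rw [← isUnit_iff_ne_zero, ← Matrix.isUnit_iff_isUnit_det, ← Matrix.linearIndependent_rows_iff_isUnit] at h
  have h2 : LinearIndependent L (fun i => T.row (f i)) := by
    refine LinearIndependent.of_comp (LinearMap.funLeft L L a) ?_
    exact h
  rw [T.rank_eq_finrank_span_row]
  have h3 := finrank_span_eq_card h2
  rw [Fintype.card_fin] at h3
  conv_lhs => rw [← h3]
  apply Submodule.finrank_mono
  apply Submodule.span_mono
  rintro _ ⟨i, rfl⟩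
  exact ⟨f i, rfl⟩

theorem ranks {D F K S p q : Type} [CommRing D] [Field F] [Field K] [Fintype p] [Fintype q]
    (φ : D →+* F) (hφ : Function.Injective φ) (ev : S → D →+* K) (hev : ∀ x, (∀ s, ev s x = 0) → x = 0)
    (T : Matrix p q D) :
    (∀ s, (T.map (ev s)).rank ≤ (T.map φ).rank) ∧ ∃ s, (T.map (ev s)).rank = (T.map φ).rank := by
  have key : ∀ s, (T.map (ev s)).rank ≤ (T.map φ).rank := by
    intro s
    obtain ⟨f, a, h⟩ := exists_minor (T.map (ev s))
    apply le_rank_of_minor _ _ f a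
    rw [Matrix.submatrix_map, ← RingHom.mapMatrix_apply, ← RingHom.map_det] at h ⊢
    intro h0
    rw [map_eq_zero_iff φ hφ] at h0
    rw [h0, map_zero] at h
    exact h rfl
  refine ⟨key, ?_⟩
  obtain ⟨f, a, h⟩ := exists_minor (T.map φ)
  rw [Matrix.submatrix_map, ← RingHom.mapMatrix_apply, ← RingHom.map_det] at h
  have h1 : (T.submatrix f a).det ≠ 0 := fun h0 => h (by rw [h0, map_zero])
  have : ∃ s, ev s (T.submatrix f a).det ≠ 0 := by
    by_contra hcon
    push Not at hcon
    exact h1 (hev _ hcon)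
  obtain ⟨s, hs⟩ := this
  refine ⟨s, le_antisymm (key s) ?_⟩
  apply le_rank_of_minor _ _ f a
  rwa [Matrix.submatrix_map, ← RingHom.mapMatrix_apply, ← RingHom.map_det]

variable {n ι : Type} [Fintype n] [DecidableEq n] [Fintype ι]

/-- matrix of the commutation system -/
def csys {R : Type} [CommRing R] (M : ι → Matrix n n R) : Matrix (ι × n × n) (n × n) R :=
  Matrix.of fun r k => M r.1 r.2.1 k.1 * (if k.2 = r.2.2 then 1 else 0)
    - (if r.2.1 = k.1 then 1 else 0) * M r.1 k.2 r.2.2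

theorem csys_map {R R' : Type} [CommRing R] [CommRing R'] (φ : R →+* R') (M : ι → Matrix n n R) :
    (csys M).map φ = csys (fun a => (M a).map φ) := by
  ext r k
  simp [csys, apply_ite φ]

theorem finrank_hs_csys {L : Type} [Field L] (M : ι → Matrix n n L) :
    (csys M).rank + Module.finrank L (hs M M) = Fintype.card (n × n) := by
  let cu : Matrix n n L ≃ₗ[L] (n × n → L) :=
    { toFun := fun m p => m p.1 p.2
      invFun := fun v => Matrix.of fun i j => v (i, j)
      map_add' := fun _ _ => rfl
      map_smul' := fun _ _ => rfl
      left_inv := fun _ => rfl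
      right_inv := fun _ => rfl }
  have hcu : ∀ x i j, cu x (i, j) = x i j := fun _ _ _ => rfl
  have h1 : (hs M M).map cu.toLinearMap = LinearMap.ker (csys M).mulVecLin := by
    have h2 : ∀ (x : Matrix n n L) r, (csys M).mulVec (cu x) r = (M r.1 * x - x * M r.1) r.2.1 r.2.2 := by
      intro x r
      simp only [csys, Matrix.mulVec, dotProduct, Matrix.of_apply, sub_mul, Finset.sum_sub_distrib, Matrix.sub_apply,
        Matrix.mul_apply, Fintype.sum_prod_type]
      congr 1
      · refine Finset.sum_congr rfl fun i _ => ?_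
        simp [hcu]
      · rw [Finset.sum_comm]
        refine Finset.sum_congr rfl fun i _ => ?_
        simp [hcu, mul_comm]
    ext v
    obtain ⟨x, rfl⟩ := cu.surjective v
    simp only [LinearMap.mem_ker, Matrix.mulVecLin_apply, funext_iff, h2, Submodule.mem_map]
    constructor
    · rintro ⟨x', hx', he⟩ r
      have : x' = x := cu.injective (funext he)
      subst this
      rw [hx' r.1, sub_self]; rfl
    · intro h
      refine ⟨x, fun a => ?_, fun _ => rfl⟩
      ext i j
      exact sub_eq_zero.mp (h (a, i, j))
  have h3 := LinearMap.finrank_range_add_finrank_ker (csys M).mulVecLin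
  rw [← h1] at h3
  have h4 : Module.finrank L ((hs M M).map cu.toLinearMap) = Module.finrank L (hs M M) := cu.finrank_map_eq _
  rw [h4] at h3
  simpa [Matrix.rank] using h3

theorem semicont {D F K S : Type} [CommRing D] [Field F] [Field K]
    (φ : D →+* F) (hφ : Function.Injective φ) (ev : S → D →+* K) (hev : ∀ x, (∀ s, ev s x = 0) → x = 0)
    (z : ι → Matrix n n D) :
    (∀ s, Module.finrank F (hs (fun a => (z a).map φ) (fun a => (z a).map φ)) ≤
      Module.finrank K (hs (fun a => (z a).map (ev s)) (fun a => (z a).map (ev s)))) ∧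
    ∃ s, Module.finrank F (hs (fun a => (z a).map φ) (fun a => (z a).map φ)) =
      Module.finrank K (hs (fun a => (z a).map (ev s)) (fun a => (z a).map (ev s))) := by
  obtain ⟨h1, s, h2⟩ := ranks φ hφ ev hev (csys z)
  have hF := finrank_hs_csys (fun a => (z a).map φ)
  have hK := fun s => finrank_hs_csys (fun a => (z a).map (ev s))
  simp only [← csys_map] at hF hK
  refine ⟨fun s => ?_, s, ?_⟩
  · have := h1 s; have := hK s; omega
  · have := hK s; omega
end ranks
end MV

namespace MV
section core
variable {n ι : Type} [Fintype n] [DecidableEq n]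

theorem trdeg_frac {K D F : Type} [Field K] [CommRing D] [IsDomain D] [Field F] [Algebra K D] [Algebra D F]
    [Algebra K F] [IsScalarTower K D F] [IsFractionRing D F] : Algebra.trdeg K F = Algebra.trdeg K D := by
  have : FaithfulSMul D F := (faithfulSMul_iff_algebraMap_injective _ F).mpr (IsFractionRing.injective D F)
  have : Algebra.IsAlgebraic D F := IsLocalization.isAlgebraic F (nonZeroDivisors D)
  have h := _root_.trdeg_add_eq K D (A := F)
  rw [_root_.trdeg_eq_zero (R := D) (A := F), add_zero] at h
  exact h.symm

theorem core1 {K D F L : Type} [Field K] [CommRing D] [IsDomain D] [Field F] [Field L]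
    [Algebra K D] [Algebra K F] [Algebra K L] [Algebra D F] [Algebra D L] [Algebra F L]
    [IsScalarTower K D F] [IsScalarTower K D L] [IsScalarTower K F L] [IsScalarTower D F L]
    [IsFractionRing D F] [Infinite F]
    (z : ι → Matrix n n D)
    (hz : Algebra.adjoin K (Set.range fun p : ι × n × n => z p.1 p.2.1 p.2.2) = ⊤)
    (g gi : Matrix n n L) (hg : gi * g = 1)
    (hind : AlgebraicIndependent F (fun p : n × n => g p.1 p.2))
    (htop : IntermediateField.adjoin F (Set.range fun p : n × n => g p.1 p.2) = ⊤) :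
    Algebra.trdeg K (Algebra.adjoin K
      ((Set.range fun p : ι × n × n => algebraMap D L (z p.1 p.2.1 p.2.2)) ∪
       (Set.range fun p : ι × n × n => (gi * (z p.1).map (algebraMap D L) * g) p.2.1 p.2.2)))
    + (Module.finrank F (hs (fun a => (z a).map (algebraMap D F)) (fun a => (z a).map (algebraMap D F))) : ℕ) =
    Algebra.trdeg K D + (Fintype.card (n × n) : ℕ) := by
  have hmm : ∀ a, ((z a).map (algebraMap D F)).map (algebraMap F L) = (z a).map (algebraMap D L) := by
    intro a; ext i j
    simp [← IsScalarTower.algebraMap_apply]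
  have hA := thmA (fun a => (z a).map (algebraMap D F)) g gi hg hind htop
    (IntermediateField.adjoin F (Set.range fun p : ι × n × n => (gi * (z p.1).map (algebraMap D L) * g) p.2.1 p.2.2))
    (by simp only [hmm])
  rw [← hA, ← add_assoc]
  congr 1
  rw [← trdeg_adjoin_eq, ← trdeg_frac (K := K) (D := D) (F := F)]
  set E := IntermediateField.adjoin F (Set.range fun p : ι × n × n => (gi * (z p.1).map (algebraMap D L) * g) p.2.1 p.2.2) with hE
  set E2 := IntermediateField.adjoin K ((Set.range fun p : ι × n × n => algebraMap D L (z p.1 p.2.1 p.2.2)) ∪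
       (Set.range fun p : ι × n × n => (gi * (z p.1).map (algebraMap D L) * g) p.2.1 p.2.2)) with hE2
  rw [_root_.trdeg_add_eq K F (A := E)]
  have hD : ∀ x : D, algebraMap D L x ∈ E2 := by
    intro x
    have hx : x ∈ Algebra.adjoin K (Set.range fun p : ι × n × n => z p.1 p.2.1 p.2.2) := by rw [hz]; trivial
    induction hx using Algebra.adjoin_induction with
    | mem x h =>
      obtain ⟨p, rfl⟩ := h
      exact IntermediateField.subset_adjoin _ _ (Or.inl ⟨p, rfl⟩)
    | algebraMap r =>
      rw [← IsScalarTower.algebraMap_apply]; exact IntermediateField.algebraMap_mem _ _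
    | add x y _ _ hx hy => rw [map_add]; exact add_mem hx hy
    | mul x y _ _ hx hy => rw [map_mul]; exact mul_mem hx hy
  have hF : ∀ x : F, algebraMap F L x ∈ E2 := by
    intro x
    obtain ⟨a, b, hb, rfl⟩ := IsFractionRing.div_surjective (A := D) x
    rw [map_div₀, ← IsScalarTower.algebraMap_apply, ← IsScalarTower.algebraMap_apply]
    exact div_mem (hD _) (hD _)
  have h1 : E2 = E.restrictScalars K := by
    apply le_antisymm
    · rw [hE2, IntermediateField.adjoin_le_iff]
      rintro _ (⟨p, rfl⟩ | ⟨p, rfl⟩)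
      · change algebraMap D L _ ∈ E
        rw [IsScalarTower.algebraMap_apply D F L]
        exact IntermediateField.algebraMap_mem _ _
      · exact IntermediateField.subset_adjoin F _ ⟨p, rfl⟩
    · let E2' : IntermediateField F L := { E2 with algebraMap_mem' := hF }
      change E ≤ E2'
      rw [hE, IntermediateField.adjoin_le_iff]
      rintro _ ⟨p, rfl⟩
      exact IntermediateField.subset_adjoin K _ (Or.inr ⟨p, rfl⟩)
  rw [h1]
  rfl

theorem core2 {K D B : Type} [Field K] [Infinite K] [CommRing D] [IsDomain D] [CommRing B] [IsDomain B]
    [Algebra K D] [Algebra K B] [Algebra D B] [IsScalarTower K D B]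
    [Algebra (MvPolynomial (n × n) D) B] [IsScalarTower D (MvPolynomial (n × n) D) B]
    [IsLocalization.Away (Matrix.mvPolynomialX n n D).det B]
    (z : ι → Matrix n n D)
    (hz : Algebra.adjoin K (Set.range fun p : ι × n × n => z p.1 p.2.1 p.2.2) = ⊤)
    (g gi : Matrix n n B) (hgX : g = (Matrix.mvPolynomialX n n D).map (algebraMap _ B)) (hg : gi * g = 1) :
    Algebra.trdeg K (Algebra.adjoin K
      ((Set.range fun p : ι × n × n => algebraMap D B (z p.1 p.2.1 p.2.2)) ∪
       (Set.range fun p : ι × n × n => (gi * (z p.1).map (algebraMap D B) * g) p.2.1 p.2.2)))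
    + (Module.finrank (FractionRing D) (hs (fun a => (z a).map (algebraMap D (FractionRing D)))
        (fun a => (z a).map (algebraMap D (FractionRing D)))) : ℕ) =
    Algebra.trdeg K D + (Fintype.card (n × n) : ℕ) := by
  let R := MvPolynomial (n × n) D
  let L := FractionRing B
  let F := FractionRing D
  have hRB : Function.Injective (algebraMap R B) :=
    IsLocalization.injective B (M := Submonoid.powers (Matrix.mvPolynomialX n n D).det)
      ((Submonoid.powers_le).mpr (mem_nonZeroDivisors_of_ne_zero (Matrix.det_mvPolynomialX_ne_zero n D)))
  have hBL : Function.Injective (algebraMap B L) := IsFractionRing.injective B L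
  have hRL : Function.Injective (algebraMap R L) := by
    rw [IsScalarTower.algebraMap_eq R B L]; exact hBL.comp hRB
  have : IsScalarTower D R L := by
    refine IsScalarTower.of_algebraMap_eq fun x => ?_
    rw [IsScalarTower.algebraMap_apply D B L, IsScalarTower.algebraMap_apply D R B, IsScalarTower.algebraMap_apply R B L]
  have hDL : Function.Injective (algebraMap D L) := by
    rw [IsScalarTower.algebraMap_eq D R L]; exact hRL.comp (MvPolynomial.C_injective _ _)
  have : FaithfulSMul D L := (faithfulSMul_iff_algebraMap_injective _ L).mpr hDL
  let : Algebra F L := FractionRing.liftAlgebra D L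
  have : IsScalarTower D F L := FractionRing.isScalarTower_liftAlgebra D L
  have : IsScalarTower K F L := by
    refine IsScalarTower.of_algebraMap_eq fun x => ?_
    rw [IsScalarTower.algebraMap_apply K D F, ← IsScalarTower.algebraMap_apply D F L,
      IsScalarTower.algebraMap_apply K B L, IsScalarTower.algebraMap_apply K D B, ← IsScalarTower.algebraMap_apply D B L]
  have : IsScalarTower K D L := by
    refine IsScalarTower.of_algebraMap_eq fun x => ?_
    rw [IsScalarTower.algebraMap_apply K B L, IsScalarTower.algebraMap_apply K D B, ← IsScalarTower.algebraMap_apply D B L]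
  have : Infinite F := Infinite.of_injective _ (algebraMap K F).injective
  have hfun : (fun p : n × n => (g.map (algebraMap B L)) p.1 p.2) = fun p => algebraMap R L (MvPolynomial.X p) := by
    ext p
    rw [hgX]
    simp only [Matrix.map_apply, Matrix.mvPolynomialX_apply]
    rw [← IsScalarTower.algebraMap_apply]
  have hindD : AlgebraicIndependent D (fun p : n × n => (g.map (algebraMap B L)) p.1 p.2) := by
    rw [hfun]
    have : MvPolynomial.aeval (R := D) (fun p : n × n => algebraMap R L (MvPolynomial.X p)) = IsScalarTower.toAlgHom D R L := by
      ext p; simp; rfl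
    rw [AlgebraicIndependent, this]
    exact hRL
  have : Algebra.IsAlgebraic D F := IsLocalization.isAlgebraic F (nonZeroDivisors D)
  have hind : AlgebraicIndependent F (fun p : n × n => (g.map (algebraMap B L)) p.1 p.2) := hindD.extendScalars F
  have htop : IntermediateField.adjoin F (Set.range fun p : n × n => (g.map (algebraMap B L)) p.1 p.2) = ⊤ := by
    rw [hfun]
    rw [← top_le_iff]
    intro x _
    have hR : ∀ r : R, algebraMap R L r ∈ IntermediateField.adjoin F (Set.range fun p : n × n => algebraMap R L (MvPolynomial.X p)) := by
      intro r
      induction r using MvPolynomial.induction_on with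
      | C a =>
        change algebraMap R L (algebraMap D R a) ∈ _
        rw [← IsScalarTower.algebraMap_apply, IsScalarTower.algebraMap_apply D F L]
        exact IntermediateField.algebraMap_mem _ _
      | add p q hp hq => rw [map_add]; exact add_mem hp hq
      | mul_X p i hp => rw [map_mul]; exact mul_mem hp (IntermediateField.subset_adjoin _ _ ⟨i, rfl⟩)
    have hB : ∀ b : B, algebraMap B L b ∈ IntermediateField.adjoin F (Set.range fun p : n × n => algebraMap R L (MvPolynomial.X p)) := by
      intro b
      obtain ⟨⟨r, s⟩, hrs⟩ := IsLocalization.surj (Submonoid.powers (Matrix.mvPolynomialX n n D).det) b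
      have hs0 : algebraMap R L s.1 ≠ 0 := by
        rw [IsScalarTower.algebraMap_apply R B L]
        have h1 := IsLocalization.map_units B s
        exact (h1.map (algebraMap B L)).ne_zero
      have : algebraMap B L b = algebraMap R L r / algebraMap R L s.1 := by
        rw [eq_div_iff hs0, IsScalarTower.algebraMap_apply R B L, IsScalarTower.algebraMap_apply R B L, ← hrs, map_mul]
      rw [this]
      exact div_mem (hR _) (hR _)
    obtain ⟨a, b, hb, rfl⟩ := IsFractionRing.div_surjective (A := B) x
    exact div_mem (hB _) (hB _)
  have h := core1 (K := K) (D := D) (F := F) (L := L) z hz (g.map (algebraMap B L)) (gi.map (algebraMap B L))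
    (by rw [← Matrix.map_mul, hg]; exact Matrix.map_one _ (map_zero _) (map_one _)) hind htop
  rw [← h]
  congr 1
  let φ : B →ₐ[K] L := IsScalarTower.toAlgHom K B L
  rw [(Subalgebra.equivMapOfInjective (Algebra.adjoin K
      ((Set.range fun p : ι × n × n => algebraMap D B (z p.1 p.2.1 p.2.2)) ∪
       (Set.range fun p : ι × n × n => (gi * (z p.1).map (algebraMap D B) * g) p.2.1 p.2.2))) φ hBL).trdeg_eq]
  rw [AlgHom.map_adjoin, Set.image_union, ← Set.range_comp, ← Set.range_comp]
  have e1 : (φ ∘ fun p : ι × n × n => algebraMap D B (z p.1 p.2.1 p.2.2)) = fun p => algebraMap D L (z p.1 p.2.1 p.2.2) := by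
    ext p; rfl
  have e2 : (φ ∘ fun p : ι × n × n => (gi * (z p.1).map (algebraMap D B) * g) p.2.1 p.2.2) =
    fun p => (gi.map (algebraMap B L) * (z p.1).map (algebraMap D L) * g.map (algebraMap B L)) p.2.1 p.2.2 := by
    ext p
    have : (gi * (z p.1).map (algebraMap D B) * g).map (algebraMap B L) =
      gi.map (algebraMap B L) * (z p.1).map (algebraMap D L) * g.map (algebraMap B L) := by
      rw [Matrix.map_mul, Matrix.map_mul]; rfl
    rw [← this]; rfl
  rw [e1, e2]
end core
end MV

namespace MV
section geo
variable {n ι : Type} [Fintype n] [DecidableEq n]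

theorem evB_exists {K D B S : Type} [Field K] [Infinite K] [CommRing D] [IsDomain D] [CommRing B]
    [Algebra K D] [Algebra K B] [Algebra D B] [IsScalarTower K D B]
    [Algebra (MvPolynomial (n × n) D) B] [IsScalarTower D (MvPolynomial (n × n) D) B]
    [IsScalarTower K (MvPolynomial (n × n) D) B]
    [IsLocalization.Away (Matrix.mvPolynomialX n n D).det B]
    (ev : S → D →ₐ[K] K) (hev : ∀ x, (∀ s, ev s x = 0) → x = 0)
    (hpt : ∀ χ : D →ₐ[K] K, ∃ s, χ = ev s) :
    ∃ evB : S → (Matrix n n K)ˣ → B →ₐ[K] K,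
      (∀ s h x, evB s h (algebraMap D B x) = ev s x) ∧
      (∀ s h i j, evB s h (algebraMap (MvPolynomial (n × n) D) B (MvPolynomial.X (i, j))) = h.1 i j) ∧
      (∀ b, (∀ s h, evB s h b = 0) → b = 0) ∧
      (∀ χ : B →ₐ[K] K, ∃ s h, χ = evB s h) := by
  let R := MvPolynomial (n × n) D
  let evR : S → (n × n → K) → R →ₐ[K] K := fun s h =>
    { MvPolynomial.eval₂Hom (ev s : D →+* K) h with
      commutes' := fun r => by
        change MvPolynomial.eval₂ (ev s : D →+* K) h (algebraMap K R r) = _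
        rw [IsScalarTower.algebraMap_apply K D R, MvPolynomial.algebraMap_eq, MvPolynomial.eval₂_C]
        simp }
  have hevR : ∀ s h r, evR s h r = MvPolynomial.eval₂ (ev s : D →+* K) h r := fun _ _ _ => rfl
  have hdet : ∀ s (h : Matrix n n K), evR s (fun p => h p.1 p.2) (Matrix.mvPolynomialX n n D).det = h.det := by
    intro s h
    rw [AlgHom.map_det]
    congr 1
    ext i j
    simp [hevR, Matrix.mvPolynomialX_apply]
  have hu : ∀ s (h : (Matrix n n K)ˣ), ∀ y : Submonoid.powers (Matrix.mvPolynomialX n n D).det,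
      IsUnit (evR s (fun p => h.1 p.1 p.2) y) := by
    rintro s h ⟨_, k, rfl⟩
    rw [map_pow, hdet]
    exact ((Matrix.isUnit_iff_isUnit_det _).mp h.isUnit).pow k
  let evB : S → (Matrix n n K)ˣ → B →ₐ[K] K := fun s h => IsLocalization.liftAlgHom (hu s h)
  have hB : ∀ s h r, evB s h (algebraMap R B r) = evR s (fun p => h.1 p.1 p.2) r := by
    intro s h r
    exact IsLocalization.lift_eq (hu s h) r
  have hBD : ∀ s h x, evB s h (algebraMap D B x) = ev s x := by
    intro s h x
    rw [IsScalarTower.algebraMap_apply D R B, hB, hevR, MvPolynomial.algebraMap_eq, MvPolynomial.eval₂_C]; rfl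
  have hBX : ∀ s h i j, evB s h (algebraMap (MvPolynomial (n × n) D) B (MvPolynomial.X (i, j))) = h.1 i j := by
    intro s h i j
    rw [hB, hevR, MvPolynomial.eval₂_X]
  refine ⟨evB, hBD, hBX, ?_, ?_⟩
  · intro b hb
    obtain ⟨⟨r, y⟩, hry⟩ := IsLocalization.surj (Submonoid.powers (Matrix.mvPolynomialX n n D).det) b
    have h1 : ∀ s (h : (Matrix n n K)ˣ), evR s (fun p => h.1 p.1 p.2) r = 0 := by
      intro s h
      rw [← hB, ← hry, map_mul, hb, zero_mul]
    have h2 : ∀ s (h : n × n → K), evR s h (r * (Matrix.mvPolynomialX n n D).det) = 0 := by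
      intro s h
      have hd := hdet s (Matrix.of fun i j => h (i, j))
      by_cases h0 : (Matrix.of fun i j => h (i, j)).det = 0
      · rw [h0] at hd
        rw [map_mul]
        have : evR s h (Matrix.mvPolynomialX n n D).det = 0 := hd
        rw [this, mul_zero]
      · have hU := (Matrix.isUnit_iff_isUnit_det (Matrix.of fun i j => h (i, j))).mpr (isUnit_iff_ne_zero.mpr h0)
        have := h1 s hU.unit
        have h3 : evR s h r = 0 := this
        rw [map_mul, h3, zero_mul]
    have h3 : r * (Matrix.mvPolynomialX n n D).det = 0 := by
      ext m
      rw [MvPolynomial.coeff_zero]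
      apply hev
      intro s
      have : MvPolynomial.map (ev s : D →+* K) (r * (Matrix.mvPolynomialX n n D).det) = 0 := by
        apply MvPolynomial.funext
        intro h
        rw [MvPolynomial.eval_map, map_zero]
        exact h2 s h
      have h4 := congrArg (MvPolynomial.coeff m) this
      rw [MvPolynomial.coeff_map] at h4
      exact h4
    have h4 : r = 0 := (mul_eq_zero.mp h3).resolve_right (Matrix.det_mvPolynomialX_ne_zero n D)
    rw [h4, map_zero] at hry
    exact (IsLocalization.map_units B y).mul_left_eq_zero.mp hry
  · intro χ
    obtain ⟨s, hs⟩ := hpt (χ.comp (IsScalarTower.toAlgHom K D B))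
    let h0 : Matrix n n K := Matrix.of fun i j => χ (algebraMap R B (MvPolynomial.X (i, j)))
    have hχR : ∀ r : R, χ (algebraMap R B r) = evR s (fun p => h0 p.1 p.2) r := by
      intro r
      induction r using MvPolynomial.induction_on with
      | C a =>
        rw [hevR, MvPolynomial.eval₂_C]
        change χ (algebraMap R B (algebraMap D R a)) = ev s a
        rw [← hs, ← IsScalarTower.algebraMap_apply]; rfl
      | add p q hp hq => simp only [map_add, hp, hq]
      | mul_X p i hp =>
        simp only [map_mul, hp]
        congr 1
        rw [hevR, MvPolynomial.eval₂_X]; rfl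
    have hU : IsUnit h0 := by
      rw [Matrix.isUnit_iff_isUnit_det, ← hdet s h0, ← hχR]
      exact (IsLocalization.Away.algebraMap_isUnit (S := B) (Matrix.mvPolynomialX n n D).det).map χ
    refine ⟨s, hU.unit, ?_⟩
    apply AlgHom.coe_ringHom_injective
    refine IsLocalization.ringHom_ext (Submonoid.powers (Matrix.mvPolynomialX n n D).det) ?_
    refine RingHom.ext fun r => ?_
    change χ (algebraMap R B r) = evB s hU.unit (algebraMap R B r)
    rw [hB, hχR]; rfl

/-- the algebra of functions generated by two matrix valued families -/
def OQ {K Q : Type} [Field K] (q1 q2 : Q → ι → Matrix n n K) : Subalgebra K (Q → K) :=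
  Algebra.adjoin K ((Set.range fun (p : ι × n × n) (q : Q) => q1 q p.1 p.2.1 p.2.2) ∪
    (Set.range fun (p : ι × n × n) (q : Q) => q2 q p.1 p.2.1 p.2.2))

theorem OQ_ft [Finite ι] {K Q : Type} [Field K] (q1 q2 : Q → ι → Matrix n n K) : Algebra.FiniteType K (OQ q1 q2) := by
  have : (OQ q1 q2).FG := Subalgebra.fg_def.mpr
    ⟨_, Set.Finite.union (Set.finite_range _) (Set.finite_range _), rfl⟩
  exact (Subalgebra.fg_iff_finiteType _).mp this

theorem geo [Fintype ι] {K D B S Q : Type} [Field K] [IsAlgClosed K] [CommRing D] [IsDomain D]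
    [Algebra K D] [Algebra.FiniteType K D]
    (ev : S → D →ₐ[K] K) (hev : ∀ x, (∀ s, ev s x = 0) → x = 0)
    (hpt : ∀ χ : D →ₐ[K] K, ∃ s, χ = ev s)
    (z : ι → Matrix n n D)
    (hz : Algebra.adjoin K (Set.range fun p : ι × n × n => z p.1 p.2.1 p.2.2) = ⊤)
    (q1 q2 : Q → ι → Matrix n n K) (π : S → (Matrix n n K)ˣ → Q) (hπ : ∀ q, ∃ s h, π s h = q)
    (h1 : ∀ s h a, q1 (π s h) a = (z a).map (ev s))
    (h2 : ∀ s h a, q2 (π s h) a = (h⁻¹).1 * (z a).map (ev s) * h.1) 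
    [CommRing B] [IsDomain B] [Algebra K B] [Algebra D B] [IsScalarTower K D B]
    [Algebra (MvPolynomial (n × n) D) B] [IsScalarTower D (MvPolynomial (n × n) D) B]
    [IsScalarTower K (MvPolynomial (n × n) D) B]
    [IsLocalization.Away (Matrix.mvPolynomialX n n D).det B] [Algebra.FiniteType K B] :
    IsDomain (OQ q1 q2) ∧ ∃ e r : ℕ, Algebra.trdeg K D = r ∧ e ≤ r + Fintype.card (n × n) ∧
      @topologicalKrullDim Q (zt (OQ q1 q2)) = ((r + Fintype.card (n × n) - e : ℕ) : WithBot ℕ∞) ∧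
      (∀ s, e ≤ Module.finrank K (hs (fun a => (z a).map (ev s)) (fun a => (z a).map (ev s)))) ∧
      (∃ s, e = Module.finrank K (hs (fun a => (z a).map (ev s)) (fun a => (z a).map (ev s)))) := by
  have : Infinite K := IsAlgClosed.instInfinite
  obtain ⟨evB, hBD, hBX, hinj, hBpt⟩ := evB_exists (B := B) (n := n) ev hev hpt
  let g : Matrix n n B := (Matrix.mvPolynomialX n n D).map (algebraMap _ B)
  have hgu : IsUnit g.det := by
    have : g.det = algebraMap _ B (Matrix.mvPolynomialX n n D).det := by
      rw [RingHom.map_det]; rfl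
    rw [this]
    exact IsLocalization.Away.algebraMap_isUnit (S := B) (Matrix.mvPolynomialX n n D).det
  have hg : g⁻¹ * g = 1 := Matrix.nonsing_inv_mul _ hgu
  have hcore := core2 (K := K) (D := D) (B := B) z hz g g⁻¹ rfl hg
  have hevg : ∀ s h, g.map (evB s h) = h.1 := by
    intro s h; ext i j
    exact hBX s h i j
  have hevgi : ∀ s h, g⁻¹.map (evB s h) = (h⁻¹).1 := by
    intro s h
    have h3 : g⁻¹.map (evB s h) * h.1 = 1 := by
      rw [← hevg s h, ← Matrix.map_mul, hg]; exact Matrix.map_one _ (map_zero _) (map_one _)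
    exact Units.eq_inv_of_mul_eq_one_right h3
  have hevz : ∀ s h a, ((z a).map (algebraMap D B)).map (evB s h) = (z a).map (ev s) := by
    intro s h a; ext i j
    exact hBD s h _
  set PB := Algebra.adjoin K
      ((Set.range fun p : ι × n × n => algebraMap D B (z p.1 p.2.1 p.2.2)) ∪
       (Set.range fun p : ι × n × n => (g⁻¹ * (z p.1).map (algebraMap D B) * g) p.2.1 p.2.2)) with hPB
  let Ev : B →ₐ[K] (S × (Matrix n n K)ˣ → K) := AlgHom.pi fun p => evB p.1 p.2
  have hEv : Function.Injective Ev := by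
    rw [injective_iff_map_eq_zero]
    intro b hb
    exact hinj b fun s h => congrFun hb (s, h)
  let pr := pre K (fun p : S × (Matrix n n K)ˣ => π p.1 p.2)
  have hpr : Function.Injective pr := by
    intro f f' hff
    ext q
    obtain ⟨s, h, rfl⟩ := hπ q
    exact congrFun hff (s, h)
  have heq : (OQ q1 q2).map pr = PB.map Ev := by
    rw [OQ, hPB, AlgHom.map_adjoin, AlgHom.map_adjoin, Set.image_union, Set.image_union, ← Set.range_comp, ← Set.range_comp,
      ← Set.range_comp, ← Set.range_comp]
    congr 3
    · ext p ⟨s, h⟩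
      change q1 (π s h) p.1 p.2.1 p.2.2 = evB s h (algebraMap D B _)
      rw [h1, hBD]; rfl
    · ext p ⟨s, h⟩
      change q2 (π s h) p.1 p.2.1 p.2.2 = (Matrix.map (g⁻¹ * (z p.1).map (algebraMap D B) * g) (evB s h)) p.2.1 p.2.2
      rw [Matrix.map_mul, Matrix.map_mul, hevg, hevgi, hevz, h2]
  let equ : OQ q1 q2 ≃ₐ[K] PB := ((Subalgebra.equivMapOfInjective (OQ q1 q2) pr hpr).trans
    (Subalgebra.equivOfEq _ _ heq)).trans (Subalgebra.equivMapOfInjective PB Ev hEv).symm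
  have hequ : ∀ x, Ev (equ x).1 = pr x.1 := by
    intro x
    have h3 := (Subalgebra.equivMapOfInjective PB Ev hEv).apply_symm_apply
      (Subalgebra.equivOfEq _ _ heq (Subalgebra.equivMapOfInjective (OQ q1 q2) pr hpr x))
    exact congrArg Subtype.val h3
  have hdom : IsDomain (OQ q1 q2) := equ.injective.isDomain (equ : OQ q1 q2 →+* PB)
  refine ⟨hdom, ?_⟩
  have hft : Algebra.FiniteType K (OQ q1 q2) := OQ_ft q1 q2
  obtain ⟨f, hf, hext⟩ := extend_points (K := K) (PB.val.comp equ.toAlgHom)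
    (fun x y h => equ.injective (Subtype.ext h))
  obtain ⟨r, hr, -⟩ := krull_eq_trdeg K D
  obtain ⟨m, hm, -⟩ := krull_eq_trdeg K (OQ q1 q2)
  obtain ⟨hs1, hs2⟩ := semicont (algebraMap D (FractionRing D)) (IsFractionRing.injective D (FractionRing D))
    (fun s => (ev s : D →+* K)) hev z
  have hcore' : m + Module.finrank (FractionRing D) (hs (fun a => (z a).map (algebraMap D (FractionRing D)))
        (fun a => (z a).map (algebraMap D (FractionRing D)))) = r + Fintype.card (n × n) := by
    rw [← equ.trdeg_eq, hm, hr] at hcore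
    exact_mod_cast hcore
  refine ⟨_, r, hr, ?_, ?_, hs1, hs2⟩
  · omega
  · refine krull_dominant (OQ q1 q2) f hf ?_ _ ?_
    · intro χ hχ
      obtain ⟨χ', hχ'⟩ := hext χ hχ
      obtain ⟨s, h, rfl⟩ := hBpt χ'
      refine ⟨π s h, fun x => ?_⟩
      rw [← hχ']
      exact congrFun (hequ x) (s, h)
    · rw [hm]
      congr 1
      omega

theorem geo2 [Fintype ι] {K D S Q : Type} [Field K] [IsAlgClosed K] [CommRing D] [IsDomain D]
    [Algebra K D] [Algebra.FiniteType K D]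
    (ev : S → D →ₐ[K] K) (hev : ∀ x, (∀ s, ev s x = 0) → x = 0)
    (hpt : ∀ χ : D →ₐ[K] K, ∃ s, χ = ev s)
    (z : ι → Matrix n n D)
    (hz : Algebra.adjoin K (Set.range fun p : ι × n × n => z p.1 p.2.1 p.2.2) = ⊤)
    (q1 q2 : Q → ι → Matrix n n K) (π : S → (Matrix n n K)ˣ → Q) (hπ : ∀ q, ∃ s h, π s h = q)
    (h1 : ∀ s h a, q1 (π s h) a = (z a).map (ev s))
    (h2 : ∀ s h a, q2 (π s h) a = (h⁻¹).1 * (z a).map (ev s) * h.1) :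
    IsDomain (OQ q1 q2) ∧ ∃ e r : ℕ, Algebra.trdeg K D = r ∧ e ≤ r + Fintype.card (n × n) ∧
      @topologicalKrullDim Q (zt (OQ q1 q2)) = ((r + Fintype.card (n × n) - e : ℕ) : WithBot ℕ∞) ∧
      (∀ s, e ≤ Module.finrank K (hs (fun a => (z a).map (ev s)) (fun a => (z a).map (ev s)))) ∧
      (∃ s, e = Module.finrank K (hs (fun a => (z a).map (ev s)) (fun a => (z a).map (ev s)))) := by
  let B := Localization.Away (Matrix.mvPolynomialX n n D).det
  have hle : Submonoid.powers (Matrix.mvPolynomialX n n D).det ≤ nonZeroDivisors _ :=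
    (Submonoid.powers_le).mpr (mem_nonZeroDivisors_of_ne_zero (Matrix.det_mvPolynomialX_ne_zero n D))
  have : IsDomain B := IsLocalization.isDomain_localization hle
  have : Algebra.FiniteType (MvPolynomial (n × n) D) B :=
    IsLocalization.finiteType_of_monoid_fg (Submonoid.powers (Matrix.mvPolynomialX n n D).det) B
  have : Algebra.FiniteType K (MvPolynomial (n × n) D) := Algebra.FiniteType.trans (S := D) inferInstance inferInstance
  have : Algebra.FiniteType K B := Algebra.FiniteType.trans (S := MvPolynomial (n × n) D) inferInstance inferInstance
  exact geo (B := B) ev hev hpt z hz q1 q2 π hπ h1 h2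

/-- the algebra of functions generated by one matrix valued family -/
def O1 {K S : Type} [Field K] (ρ : S → ι → Matrix n n K) : Subalgebra K (S → K) :=
  Algebra.adjoin K (Set.range fun (p : ι × n × n) (s : S) => ρ s p.1 p.2.1 p.2.2)

theorem O1_ft [Finite ι] {K S : Type} [Field K] (ρ : S → ι → Matrix n n K) : Algebra.FiniteType K (O1 ρ) := by
  have : (O1 ρ).FG := Subalgebra.fg_def.mpr ⟨_, Set.finite_range _, rfl⟩
  exact (Subalgebra.fg_iff_finiteType _).mp this

theorem geo3 [Fintype ι] {K S Q : Type} [Field K] [IsAlgClosed K]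
    (ρ : S → ι → Matrix n n K) (hdom : IsDomain (O1 ρ))
    (hpt : ∀ χ : O1 ρ →ₐ[K] K, ∃ s, ∀ g : O1 ρ, χ g = g.1 s)
    (q1 q2 : Q → ι → Matrix n n K) (π : S → (Matrix n n K)ˣ → Q) (hπ : ∀ q, ∃ s h, π s h = q)
    (h1 : ∀ s h a, q1 (π s h) a = ρ s a)
    (h2 : ∀ s h a, q2 (π s h) a = (h⁻¹).1 * ρ s a * h.1) :
    IsDomain (OQ q1 q2) ∧ ∃ e r : ℕ, Algebra.trdeg K (O1 ρ) = r ∧ e ≤ r + Fintype.card (n × n) ∧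
      @topologicalKrullDim Q (zt (OQ q1 q2)) = ((r + Fintype.card (n × n) - e : ℕ) : WithBot ℕ∞) ∧
      (∀ s, e ≤ Module.finrank K (hs (ρ s) (ρ s))) ∧
      (∃ s, e = Module.finrank K (hs (ρ s) (ρ s))) := by
  have := O1_ft ρ
  let ev : S → O1 ρ →ₐ[K] K := fun s => (Pi.evalAlgHom K (fun _ : S => K) s).comp (O1 ρ).val
  have hev : ∀ x, (∀ s, ev s x = 0) → x = 0 := by
    intro x hx
    ext s
    exact hx s
  let z : ι → Matrix n n (O1 ρ) := fun a => Matrix.of fun i j =>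
    ⟨fun s => ρ s a i j, Algebra.subset_adjoin ⟨(a, i, j), rfl⟩⟩
  have hz : Algebra.adjoin K (Set.range fun p : ι × n × n => z p.1 p.2.1 p.2.2) = ⊤ := by
    have h3 : (Algebra.adjoin K (Set.range fun p : ι × n × n => z p.1 p.2.1 p.2.2)).map (O1 ρ).val = (⊤ : Subalgebra K (O1 ρ)).map (O1 ρ).val := by
      rw [AlgHom.map_adjoin, ← Set.range_comp, Algebra.map_top, Subalgebra.range_val]
      rfl
    exact Subalgebra.map_injective (f := (O1 ρ).val) Subtype.val_injective h3
  have hzev : ∀ s a, (z a).map (ev s) = ρ s a := by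
    intro s a; ext i j; rfl
  have := geo2 ev hev (fun χ => (hpt χ).imp fun s hs => AlgHom.ext hs) z hz q1 q2 π hπ
    (fun s h a => by rw [h1, hzev]) (fun s h a => by rw [h2, hzev])
  have hzev' : ∀ s, (fun a => (z a).map (ev s)) = ρ s := fun s => funext (hzev s)
  have hfr : ∀ s, Module.finrank K (hs (fun a => (z a).map (ev s)) (fun a => (z a).map (ev s))) =
      Module.finrank K (hs (ρ s) (ρ s)) := fun s => by rw [← hzev' s]
  obtain ⟨g1, e, r, g2, g3, g4, g5, s, g6⟩ := this
  exact ⟨g1, e, r, g2, g3, g4, fun s => (g5 s).trans (hfr s).le, s, g6.trans (hfr s)⟩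
end geo
end MV

namespace MV
section prod
variable {n ι : Type} [Fintype n] [DecidableEq n]

theorem integral_aux {R S D O : Type} [CommRing R] [CommRing S] [CommRing D] [CommRing O]
    (g : R →+* D) (Φ : S →+* O) (i : R →+* S) (j : D →+* O) (h : Φ.comp i = j.comp g) (x : D)
    (hx : g.IsIntegralElem x) : Φ.IsIntegralElem (j x) := by
  obtain ⟨p, hp, hp0⟩ := hx
  refine ⟨p.map i, hp.map i, ?_⟩
  rw [Polynomial.eval₂_map, h, ← Polynomial.hom_eval₂, hp0, map_zero]

theorem prod_dim [Fintype ι] {K S Q : Type} [Field K] [IsAlgClosed K]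
    (ρ : S → ι → Matrix n n K)
    (hpt : ∀ χ : O1 ρ →ₐ[K] K, ∃ s, ∀ g : O1 ρ, χ g = g.1 s)
    [Nontrivial (O1 ρ)]
    (p1 p2 : Q → S) (hp : ∀ s t, ∃ q, p1 q = s ∧ p2 q = t) (r : ℕ)
    (hr : ringKrullDim (O1 ρ) = (r : WithBot ℕ∞)) :
    @topologicalKrullDim Q (zt (OQ (fun q => ρ (p1 q)) (fun q => ρ (p2 q)))) = ((r + r : ℕ) : WithBot ℕ∞) := by
  have : Infinite K := IsAlgClosed.instInfinite
  have := O1_ft ρ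
  set O := OQ (fun q => ρ (p1 q)) (fun q => ρ (p2 q)) with hO
  have : Algebra.FiniteType K O := OQ_ft _ _
  have m1 : (O1 ρ).map (pre K p1) ≤ O := by
    rw [O1, AlgHom.map_adjoin, ← Set.range_comp]
    exact Algebra.adjoin_mono Set.subset_union_left
  have m2 : (O1 ρ).map (pre K p2) ≤ O := by
    rw [O1, AlgHom.map_adjoin, ← Set.range_comp]
    exact Algebra.adjoin_mono Set.subset_union_right
  let j1 : O1 ρ →ₐ[K] O := ((pre K p1).comp (O1 ρ).val).codRestrict O (fun x => m1 ⟨x.1, x.2, rfl⟩)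
  let j2 : O1 ρ →ₐ[K] O := ((pre K p2).comp (O1 ρ).val).codRestrict O (fun x => m2 ⟨x.1, x.2, rfl⟩)
  have hj1 : ∀ x q, (j1 x).1 q = x.1 (p1 q) := fun _ _ => rfl
  have hj2 : ∀ x q, (j2 x).1 q = x.1 (p2 q) := fun _ _ => rfl
  -- every subalgebra containing the images of `j1`, `j2` is everything
  have hgen : ∀ x : O, x ∈ Algebra.adjoin K (Set.range j1 ∪ Set.range j2) := by
    intro x
    have h3 : O.1 ≤ ((Algebra.adjoin K (Set.range j1 ∪ Set.range j2)).map O.val).1 := by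
      change O ≤ (Algebra.adjoin K (Set.range j1 ∪ Set.range j2)).map O.val
      conv_lhs => rw [hO, OQ]
      refine Algebra.adjoin_le ?_
      rintro _ (⟨p, rfl⟩ | ⟨p, rfl⟩)
      · exact ⟨j1 ⟨fun s => ρ s p.1 p.2.1 p.2.2, Algebra.subset_adjoin ⟨p, rfl⟩⟩,
          Algebra.subset_adjoin (Or.inl ⟨_, rfl⟩), rfl⟩
      · exact ⟨j2 ⟨fun s => ρ s p.1 p.2.1 p.2.2, Algebra.subset_adjoin ⟨p, rfl⟩⟩,
          Algebra.subset_adjoin (Or.inr ⟨_, rfl⟩), rfl⟩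
    obtain ⟨y, hy, hyx⟩ := h3 x.2
    have : y = x := Subtype.ext hyx
    exact this ▸ hy
  rw [krull_closed O ?_]
  · obtain ⟨k, g, hg, hgi⟩ := exists_integral_inj_algHom_of_fg K (O1 ρ)
    let Φ : MvPolynomial (Fin k ⊕ Fin k) K →ₐ[K] O :=
      MvPolynomial.aeval (Sum.elim (fun i => j1 (g (MvPolynomial.X i))) (fun i => j2 (g (MvPolynomial.X i))))
    have hi1 : Φ.comp (MvPolynomial.rename Sum.inl) = j1.comp g := by
      apply MvPolynomial.algHom_ext
      intro i
      simp [Φ]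
    have hi2 : Φ.comp (MvPolynomial.rename Sum.inr) = j2.comp g := by
      apply MvPolynomial.algHom_ext
      intro i
      simp [Φ]
    let u : S → Fin k → K := fun s i => (g (MvPolynomial.X i)).1 s
    have hgu : ∀ P s, (g P).1 s = MvPolynomial.eval (u s) P := by
      intro P s
      have : ((Pi.evalAlgHom K (fun _ : S => K) s).comp (O1 ρ).val).comp g = MvPolynomial.aeval (u s) := by
        apply MvPolynomial.algHom_ext
        intro i
        simp [u]
      exact DFunLike.congr_fun this P
    have hΦu : ∀ P q, (Φ P).1 q = MvPolynomial.eval (Sum.elim (u (p1 q)) (u (p2 q))) P := by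
      intro P q
      have : ((Pi.evalAlgHom K (fun _ : Q => K) q).comp O.val).comp Φ =
          MvPolynomial.aeval (Sum.elim (u (p1 q)) (u (p2 q))) := by
        apply MvPolynomial.algHom_ext
        rintro (i | i)
        · simp [u, Φ, hj1]
        · simp [u, Φ, hj2]
      exact DFunLike.congr_fun this P
    have hinj : Function.Injective Φ := by
      rw [injective_iff_map_eq_zero]
      intro P hP
      have h1 : ∀ s t, MvPolynomial.eval (Sum.elim (u s) (u t)) P = 0 := by
        intro s t
        obtain ⟨q, rfl, rfl⟩ := hp s t
        rw [← hΦu, hP]; rfl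
      have h2 : ∀ x t, MvPolynomial.eval (Sum.elim x (u t)) P = 0 := by
        intro x t
        let P' : MvPolynomial (Fin k) K := MvPolynomial.aeval (Sum.elim MvPolynomial.X (fun i => MvPolynomial.C (u t i))) P
        have hP' : ∀ y, MvPolynomial.eval y P' = MvPolynomial.eval (Sum.elim y (u t)) P := by
          intro y
          have : (MvPolynomial.aeval y : MvPolynomial (Fin k) K →ₐ[K] K).comp (MvPolynomial.aeval (Sum.elim MvPolynomial.X (fun i => MvPolynomial.C (u t i)))) = MvPolynomial.aeval (Sum.elim y (u t)) := by
            apply MvPolynomial.algHom_ext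
            rintro (i | i) <;> simp
          exact DFunLike.congr_fun this P
        have h0 : P' = 0 := by
          apply hg
          rw [map_zero]
          ext s
          rw [hgu, hP', h1]; rfl
        rw [← hP', h0, map_zero]
      have h3 : ∀ x y, MvPolynomial.eval (Sum.elim x y) P = 0 := by
        intro x y
        let P' : MvPolynomial (Fin k) K := MvPolynomial.aeval (Sum.elim (fun i => MvPolynomial.C (x i)) MvPolynomial.X) P
        have hP' : ∀ y, MvPolynomial.eval y P' = MvPolynomial.eval (Sum.elim x y) P := by
          intro y
          have : (MvPolynomial.aeval y : MvPolynomial (Fin k) K →ₐ[K] K).comp (MvPolynomial.aeval (Sum.elim (fun i => MvPolynomial.C (x i)) MvPolynomial.X)) = MvPolynomial.aeval (Sum.elim x y) := by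
            apply MvPolynomial.algHom_ext
            rintro (i | i) <;> simp
          exact DFunLike.congr_fun this P
        have h0 : P' = 0 := by
          apply hg
          rw [map_zero]
          ext s
          rw [hgu, hP', h2]; rfl
        rw [← hP', h0, map_zero]
      apply MvPolynomial.funext
      intro x
      rw [map_zero, ← h3 (x ∘ Sum.inl) (x ∘ Sum.inr), Sum.elim_comp_inl_inr]
    have hint : ∀ x : O, Φ.toRingHom.IsIntegralElem x := by
      intro x
      induction hgen x using Algebra.adjoin_induction with
      | mem x hx =>
        rcases hx with ⟨y, rfl⟩ | ⟨y, rfl⟩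
        · exact integral_aux g.toRingHom Φ.toRingHom (MvPolynomial.rename Sum.inl).toRingHom j1.toRingHom
            (congrArg AlgHom.toRingHom hi1) y (hgi y)
        · exact integral_aux g.toRingHom Φ.toRingHom (MvPolynomial.rename Sum.inr).toRingHom j2.toRingHom
            (congrArg AlgHom.toRingHom hi2) y (hgi y)
      | algebraMap c =>
        have : algebraMap K O c = Φ.toRingHom (MvPolynomial.C c) := (Φ.commutes c).symm
        rw [this]
        exact Φ.toRingHom.isIntegralElem_map
      | add x y _ _ hx hy => exact RingHom.IsIntegralElem.add _ hx hy
      | mul x y _ _ hx hy => exact RingHom.IsIntegralElem.mul _ hx hy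
    have e1 : ringKrullDim O = ringKrullDim (MvPolynomial (Fin k ⊕ Fin k) K) := by
      letI := Φ.toRingHom.toAlgebra
      have : Algebra.IsIntegral (MvPolynomial (Fin k ⊕ Fin k) K) O := ⟨hint⟩
      exact krull_integral hinj
    have e2 : ringKrullDim (O1 ρ) = ringKrullDim (MvPolynomial (Fin k) K) := by
      letI := g.toRingHom.toAlgebra
      have : Algebra.IsIntegral (MvPolynomial (Fin k) K) (O1 ρ) := ⟨hgi⟩
      exact krull_integral hg
    rw [e1, MvPolynomial.ringKrullDim_of_isNoetherianRing, ringKrullDim_eq_zero_of_field]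
    rw [hr, MvPolynomial.ringKrullDim_of_isNoetherianRing, ringKrullDim_eq_zero_of_field] at e2
    have hk : r = k := by
      simp only [Nat.card_eq_fintype_card, Fintype.card_fin, zero_add] at e2
      exact_mod_cast e2
    subst hk
    simp
  · intro χ
    obtain ⟨s, hs⟩ := hpt (χ.comp j1)
    obtain ⟨t, ht⟩ := hpt (χ.comp j2)
    obtain ⟨q, rfl, rfl⟩ := hp s t
    refine ⟨q, fun x => ?_⟩
    induction hgen x using Algebra.adjoin_induction with
    | mem x hx =>
      rcases hx with ⟨y, rfl⟩ | ⟨y, rfl⟩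
      · exact hs y
      · exact ht y
    | algebraMap c => exact χ.commutes c
    | add x y _ _ hx hy => rw [map_add, hx, hy]; rfl
    | mul x y _ _ hx hy => rw [map_mul, hx, hy]; rfl
end prod
end MV

namespace MV
section fin
variable {K A : Type} [Field K] [Ring A] [Algebra K A] {d : ℕ} {ι : Type} [Fintype ι]

theorem mem_O1 {S : Type} (ρ : S → ι → Matrix (Fin d) (Fin d) K) (k : ι) (i j : Fin d) :
    (fun s => ρ s k i j) ∈ O1 ρ := Algebra.subset_adjoin ⟨(k, i, j), rfl⟩

theorem mem_OQ1 {S : Type} (ρ τ : S → ι → Matrix (Fin d) (Fin d) K) (k : ι) (i j : Fin d) :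
    (fun s => ρ s k i j) ∈ OQ ρ τ := Algebra.subset_adjoin (Or.inl ⟨(k, i, j), rfl⟩)

theorem mem_OQ2 {S : Type} (ρ τ : S → ι → Matrix (Fin d) (Fin d) K) (k : ι) (i j : Fin d) :
    (fun s => τ s k i j) ∈ OQ ρ τ := Algebra.subset_adjoin (Or.inr ⟨(k, i, j), rfl⟩)

theorem dual_expand (b : Module.Basis ι K A) (f : Module.Dual K (A →ₗ[K] Matrix (Fin d) (Fin d) K)) :
    ∃ c : ι → Fin d → Fin d → K, ∀ L, f L = ∑ k, ∑ i, ∑ j, c k i j * L (b k) i j := by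
  refine ⟨fun k i j => f ((b.coord k).smulRight (Matrix.single i j 1)), fun L => ?_⟩
  have hL : L = ∑ k, ∑ i, ∑ j, L (b k) i j • (b.coord k).smulRight (Matrix.single i j (1 : K)) := by
    apply b.ext
    intro k
    classical
    simp only [LinearMap.sum_apply, LinearMap.smul_apply, LinearMap.smulRight_apply, Module.Basis.coord_apply,
      Module.Basis.repr_self, Finsupp.single_apply]
    rw [Finset.sum_eq_single k]
    · simp only [if_true, one_smul, Matrix.smul_single, smul_eq_mul, mul_one]
      exact Matrix.matrix_eq_sum_single _
    · intro k' _ hk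
      simp [Ne.symm hk]
    · simp
  conv_lhs => rw [hL]
  simp only [map_sum, map_smul, smul_eq_mul, mul_comm]

/-- the entry functional -/
noncomputable def entF (b : Module.Basis ι K A) (p : ι × Fin d × Fin d) : Module.Dual K (A →ₗ[K] Matrix (Fin d) (Fin d) K) where
  toFun L := L (b p.1) p.2.1 p.2.2
  map_add' _ _ := rfl
  map_smul' _ _ := rfl

theorem top1 {Y : Type} (b : Module.Basis ι K A) (φ : Y → A →ₗ[K] Matrix (Fin d) (Fin d) K) :
    TopologicalSpace.induced φ (zariskiTopology K (A →ₗ[K] Matrix (Fin d) (Fin d) K)) =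
      zt (O1 (fun y k => φ y (b k))) := by
  refine (induced_zt φ (Algebra.adjoin K (Set.range fun (φ : Module.Dual K (A →ₗ[K] Matrix (Fin d) (Fin d) K)) => (φ : _ → K)))).trans ?_
  congr 1
  rw [AlgHom.map_adjoin, ← Set.range_comp]
  apply le_antisymm
  · refine Algebra.adjoin_le ?_
    rintro _ ⟨f, rfl⟩
    obtain ⟨c, hc⟩ := dual_expand b f
    have : (⇑(pre K φ) ∘ fun f : Module.Dual K (A →ₗ[K] Matrix (Fin d) (Fin d) K) => (f : _ → K)) f =
        ∑ k, ∑ i, ∑ j, c k i j • (fun y => φ y (b k) i j) := by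
      ext y
      simp [hc]
    rw [this]
    refine Subalgebra.sum_mem _ fun k _ => Subalgebra.sum_mem _ fun i _ => Subalgebra.sum_mem _ fun j _ =>
      Subalgebra.smul_mem _ (mem_O1 (fun y k => φ y (b k)) k i j) _
  · refine Algebra.adjoin_mono ?_
    rintro _ ⟨p, rfl⟩
    exact ⟨entF b p, rfl⟩

theorem top2 {Y : Type} (b : Module.Basis ι K A) (φ ψ : Y → A →ₗ[K] Matrix (Fin d) (Fin d) K) :
    TopologicalSpace.induced (fun y => (φ y, ψ y)) (zariskiTopology K ((A →ₗ[K] Matrix (Fin d) (Fin d) K) × (A →ₗ[K] Matrix (Fin d) (Fin d) K))) =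
      zt (OQ (fun y k => φ y (b k)) (fun y k => ψ y (b k))) := by
  refine (induced_zt (fun y => (φ y, ψ y)) (Algebra.adjoin K (Set.range fun (φ : Module.Dual K ((A →ₗ[K] Matrix (Fin d) (Fin d) K) × (A →ₗ[K] Matrix (Fin d) (Fin d) K))) => (φ : _ → K)))).trans ?_
  congr 1
  rw [AlgHom.map_adjoin, ← Set.range_comp]
  apply le_antisymm
  · refine Algebra.adjoin_le ?_
    rintro _ ⟨f, rfl⟩
    obtain ⟨c, hc⟩ := dual_expand b (f.comp (LinearMap.inl K _ _))
    obtain ⟨c', hc'⟩ := dual_expand b (f.comp (LinearMap.inr K _ _))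
    have hf : ∀ x y, f (x, y) = f (x, 0) + f (0, y) := by
      intro x y; rw [← map_add]; simp
    have : (⇑(pre K (fun y => (φ y, ψ y))) ∘ fun f : Module.Dual K ((A →ₗ[K] Matrix (Fin d) (Fin d) K) × (A →ₗ[K] Matrix (Fin d) (Fin d) K)) => (f : _ → K)) f =
        (∑ k, ∑ i, ∑ j, c k i j • (fun y => φ y (b k) i j)) + 
        (∑ k, ∑ i, ∑ j, c' k i j • (fun y => ψ y (b k) i j)) := by
      ext y
      have h1 := hc (φ y)
      have h2 := hc' (ψ y)
      simp only [LinearMap.comp_apply, LinearMap.inl_apply, LinearMap.inr_apply] at h1 h2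
      change f (φ y, ψ y) = _
      rw [hf, h1, h2]
      simp only [Pi.add_apply, Finset.sum_apply, Pi.smul_apply, smul_eq_mul]
    rw [this]
    refine Subalgebra.add_mem _ ?_ ?_
    · refine Subalgebra.sum_mem _ fun k _ => Subalgebra.sum_mem _ fun i _ => Subalgebra.sum_mem _ fun j _ =>
        Subalgebra.smul_mem _ (mem_OQ1 (fun y k => φ y (b k)) (fun y k => ψ y (b k)) k i j) _
    · refine Subalgebra.sum_mem _ fun k _ => Subalgebra.sum_mem _ fun i _ => Subalgebra.sum_mem _ fun j _ =>
        Subalgebra.smul_mem _ (mem_OQ2 (fun y k => φ y (b k)) (fun y k => ψ y (b k)) k i j) _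
  · refine Algebra.adjoin_mono ?_
    rintro _ (⟨p, rfl⟩ | ⟨p, rfl⟩)
    · exact ⟨(entF b p).comp (LinearMap.fst K _ _), rfl⟩
    · exact ⟨(entF b p).comp (LinearMap.snd K _ _), rfl⟩

theorem topMod (b : Module.Basis ι K A) :
    (inferInstance : TopologicalSpace (ModVar K A d)) = zt (O1 (fun (M : ModVar K A d) k => M (b k))) :=
  top1 b (fun M : ModVar K A d => M.toLinearMap)

theorem topSub (b : Module.Basis ι K A) (C : Set (ModVar K A d)) :
    (inferInstance : TopologicalSpace C) = zt (O1 (fun (M : C) k => M.1 (b k))) := by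
  refine Eq.trans ?_ (top1 b (fun M : C => M.1.toLinearMap))
  exact induced_compose

theorem topProd (b : Module.Basis ι K A) (C : Set (ModVar K A d × ModVar K A d)) :
    (TopologicalSpace.induced Subtype.val (prodZariski K A d d) : TopologicalSpace C) =
      zt (OQ (fun (p : C) k => p.1.1 (b k)) (fun (p : C) k => p.1.2 (b k))) := by
  refine Eq.trans ?_ (top2 b (fun p : C => p.1.1.toLinearMap) (fun p : C => p.1.2.toLinearMap))
  exact induced_compose

theorem ent_mem (b : Module.Basis ι K A) (C : Set (ModVar K A d)) (a : A) (i j : Fin d) :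
    (fun M : C => M.1 a i j) ∈ O1 (fun (M : C) k => M.1 (b k)) := by
  have : (fun M : C => M.1 a i j) = ∑ k, b.repr a k • (fun M : C => M.1 (b k) i j) := by
    ext M
    conv_lhs => rw [← b.sum_repr a]
    rw [map_sum]
    simp only [map_smul, Matrix.sum_apply, Matrix.smul_apply, Finset.sum_apply, Pi.smul_apply]
  rw [this]
  exact Subalgebra.sum_mem _ fun k _ => Subalgebra.smul_mem _ (mem_O1 (fun (M : C) k => M.1 (b k)) k i j) _

theorem pt_closed (b : Module.Basis ι K A) (C : Set (ModVar K A d)) (hC : IsClosed C)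
    (χ : O1 (fun (M : C) k => M.1 (b k)) →ₐ[K] K) : ∃ s : C, ∀ g : O1 (fun (M : C) k => M.1 (b k)), χ g = g.1 s := by
  let ea : A → Fin d → Fin d → O1 (fun (M : C) k => M.1 (b k)) := fun a i j => ⟨fun M => M.1 a i j, ent_mem b C a i j⟩
  let L : A →ₗ[K] Matrix (Fin d) (Fin d) K :=
    { toFun := fun a => Matrix.of fun i j => χ (ea a i j)
      map_add' := fun x y => by
        ext i j
        have : ea (x + y) i j = ea x i j + ea y i j := by
          apply Subtype.ext; funext M; simp [ea]
        simp [this]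
      map_smul' := fun c x => by
        ext i j
        have : ea (c • x) i j = c • ea x i j := by
          apply Subtype.ext; funext M; simp [ea]
        simp [this] }
  let M0 : ModVar K A d := AlgHom.ofLinearMap L (by
      ext i j
      have : ea 1 i j = algebraMap K _ ((1 : Matrix (Fin d) (Fin d) K) i j) := by
        apply Subtype.ext; funext M; simp [ea]
      change χ (ea 1 i j) = _
      rw [this, AlgHom.commutes]; rfl) (by
      intro x y
      ext i j
      have : ea (x * y) i j = ∑ l, ea x i l * ea y l j := by
        apply Subtype.ext; funext M; simp [ea, Matrix.mul_apply]
      change χ (ea (x * y) i j) = _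
      rw [this, Matrix.mul_apply, map_sum]
      simp only [map_mul]; rfl)
  have hM0 : ∀ a i j, M0 a i j = χ (ea a i j) := fun _ _ _ => rfl
  have hres : (O1 (fun (M : ModVar K A d) k => M (b k))).map (pre K (Subtype.val : C → _)) =
      O1 (fun (M : C) k => M.1 (b k)) := by
    rw [O1, AlgHom.map_adjoin, ← Set.range_comp]; rfl
  have key : ∀ f (hf : f ∈ O1 (fun (M : ModVar K A d) k => M (b k))),
      χ ⟨pre K (Subtype.val : C → _) f, hres ▸ ⟨f, hf, rfl⟩⟩ = f M0 := by
    intro f hf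
    induction hf using Algebra.adjoin_induction with
    | mem x hx =>
      obtain ⟨p, rfl⟩ := hx
      exact (hM0 _ _ _).symm
    | algebraMap c => exact χ.commutes c
    | add x y hx hy h1 h2 =>
      rw [Pi.add_apply, ← h1, ← h2, ← map_add]; rfl
    | mul x y hx hy h1 h2 =>
      rw [Pi.mul_apply, ← h1, ← h2, ← map_mul]; rfl
  have hmem : M0 ∈ C := by
    by_contra hno
    have hC' : IsClosed[zt (O1 (fun (M : ModVar K A d) k => M (b k)))] C := by
      rw [← topMod b]; exact hC
    obtain ⟨f, hf, h1, h2⟩ := exists_sep _ C hC' M0 hno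
    apply h2
    rw [← key f hf]
    have : (⟨pre K (Subtype.val : C → _) f, hres ▸ ⟨f, hf, rfl⟩⟩ : O1 (fun (M : C) k => M.1 (b k))) = 0 := by
      apply Subtype.ext; funext M; exact h1 M.1 M.2
    rw [this, map_zero]
  refine ⟨⟨M0, hmem⟩, ?_⟩
  rintro ⟨g, hg⟩
  have hg' := hg
  rw [← hres] at hg'
  obtain ⟨f, hf, rfl⟩ := hg'
  exact key f hf

/-- conjugation -/
def conj (M : ModVar K A d) (h : (Matrix (Fin d) (Fin d) K)ˣ) : ModVar K A d :=
  AlgHom.ofLinearMap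
    { toFun := fun a => (h⁻¹).1 * M a * h.1
      map_add' := fun x y => by rw [map_add, mul_add, add_mul]
      map_smul' := fun c x => by simp }
    (by simp)
    (fun x y => by
      change (h⁻¹).1 * M (x * y) * h.1 = ((h⁻¹).1 * M x * h.1) * ((h⁻¹).1 * M y * h.1)
      simp only [map_mul, mul_assoc, Units.mul_inv_cancel_left])

theorem conj_apply (M : ModVar K A d) (h : (Matrix (Fin d) (Fin d) K)ˣ) (a : A) :
    conj M h a = (h⁻¹).1 * M a * h.1 := rfl

theorem conj_mem (M : ModVar K A d) (h : (Matrix (Fin d) (Fin d) K)ˣ) : conj M h ∈ orbitSet K A M :=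
  ⟨h, fun _ => rfl⟩

theorem exists_conj (M N : ModVar K A d) (h : N ∈ orbitSet K A M) : ∃ g, conj M g = N := by
  obtain ⟨g, hg⟩ := h
  exact ⟨g, AlgHom.ext fun a => (hg a).symm⟩

theorem orbit_dim [IsAlgClosed K] (b : Module.Basis ι K A) (M : ModVar K A d) :
    topologicalKrullDim (orbitSet K A M) =
      ((Fintype.card (Fin d × Fin d) - Module.finrank K (hs (fun k => M (b k)) (fun k => M (b k))) : ℕ) : WithBot ℕ∞) := by
  let ρ : Unit → ι → Matrix (Fin d) (Fin d) K := fun _ k => M (b k)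
  have hconst : ∀ f : O1 ρ, f = algebraMap K _ (f.1 ()) := by
    intro f; apply Subtype.ext; funext x; rfl
  have hdom : IsDomain (O1 ρ) := by
    let e : O1 ρ →ₐ[K] K := (Pi.evalAlgHom K (fun _ : Unit => K) ()).comp (O1 ρ).val
    have he : Function.Injective e := by
      intro x y hxy
      apply Subtype.ext; funext u; exact hxy
    exact he.isDomain (e : O1 ρ →+* K)
  have hpt : ∀ χ : O1 ρ →ₐ[K] K, ∃ s, ∀ g : O1 ρ, χ g = g.1 s := by
    intro χ
    refine ⟨(), fun g => ?_⟩
    conv_lhs => rw [hconst g]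
    exact χ.commutes _
  have halg : Algebra.IsAlgebraic K (O1 ρ) := ⟨fun f => by rw [hconst f]; exact isAlgebraic_algebraMap _⟩
  have htr : Algebra.trdeg K (O1 ρ) = 0 := _root_.trdeg_eq_zero
  obtain ⟨-, e, r, h1, h2, h3, h4, s, h5⟩ := geo3 ρ hdom hpt (Q := orbitSet K A M)
    (fun _ k => M (b k)) (fun N k => N.1 (b k)) (fun _ h => ⟨conj M h, conj_mem M h⟩)
    (fun q => by
      obtain ⟨g, hg⟩ := exists_conj M q.1 q.2
      exact ⟨(), g, Subtype.ext hg⟩) (fun _ _ _ => rfl) (fun _ _ _ => rfl)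
  have hr : r = 0 := by rw [htr] at h1; exact_mod_cast h1.symm
  subst hr
  have hO : OQ (fun (_ : orbitSet K A M) k => M (b k)) (fun (N : orbitSet K A M) k => N.1 (b k)) =
      O1 (fun (N : orbitSet K A M) k => N.1 (b k)) := by
    apply le_antisymm
    · refine Algebra.adjoin_le ?_
      rintro _ (⟨p, rfl⟩ | ⟨p, rfl⟩)
      · exact (O1 _).algebraMap_mem (M (b p.1) p.2.1 p.2.2)
      · exact Algebra.subset_adjoin ⟨p, rfl⟩
    · exact Algebra.adjoin_mono Set.subset_union_right
  rw [hO] at h3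
  have ht := topSub b (orbitSet K A M)
  rw [← ht, zero_add, h5] at h3
  exact h3

theorem main [IsAlgClosed K] (b : Module.Basis ι K A)
    (Z : Set (ModVar K A d)) (hZ : Z ∈ irreducibleComponents (ModVar K A d))
    (dimZ dimZZ dimIso : ℕ) (dimOrb : ModVar K A d → ℕ)
    (hdimZ : topologicalKrullDim Z = (dimZ : WithBot ℕ∞))
    (hdimZZ : @topologicalKrullDim ↥(Z ×ˢ Z)
      (TopologicalSpace.induced Subtype.val (prodZariski K A d d)) = (dimZZ : WithBot ℕ∞))
    (hdimIso : @topologicalKrullDim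
      ↥{p : ModVar K A d × ModVar K A d | p.1 ∈ Z ∧ p.2 ∈ Z ∧ p.2 ∈ orbitSet K A p.1}
      (TopologicalSpace.induced Subtype.val (prodZariski K A d d)) = (dimIso : WithBot ℕ∞))
    (hdimOrb : ∀ M ∈ Z, topologicalKrullDim (orbitSet K A M) = (dimOrb M : WithBot ℕ∞)) :
    dimZZ - dimIso = sInf {k : ℕ | ∃ M ∈ Z, k = dimZ - dimOrb M} := by
  have hZc : IsClosed Z := isClosed_of_mem_irreducibleComponents Z hZ
  have hZi : IsIrreducible Z := hZ.1
  let ρ : Z → ι → Matrix (Fin d) (Fin d) K := fun M k => M.1 (b k)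
  have hpt := pt_closed b Z hZc
  have htZ := topSub b Z
  have hdom : IsDomain (O1 ρ) := by
    have h1 : @IsIrreducible Z (zt (O1 ρ)) Set.univ := by
      rw [← htZ]
      have : IrreducibleSpace Z := Subtype.irreducibleSpace hZi
      exact IrreducibleSpace.isIrreducible_univ _
    have h2 := vid_prime (O1 ρ) Set.univ h1
    have h3 : vid (O1 ρ) Set.univ = ⊥ := by
      rw [eq_bot_iff]
      intro f hf
      rw [Ideal.mem_bot]
      apply Subtype.ext; funext x; exact hf x trivial
    rw [h3] at h2
    exact IsDomain.of_bot_isPrime _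
  have hft := O1_ft ρ
  obtain ⟨g1, e, r, h1, h2, h3, h4, M1, h5⟩ := geo3 ρ hdom hpt
    (Q := ↥{p : ModVar K A d × ModVar K A d | p.1 ∈ Z ∧ p.2 ∈ orbitSet K A p.1})
    (fun p k => p.1.1 (b k)) (fun p k => p.1.2 (b k)) (fun M h => ⟨(M.1, conj M.1 h), M.2, conj_mem M.1 h⟩)
    (fun q => by
      obtain ⟨g, hg⟩ := exists_conj q.1.1 q.1.2 q.2.2
      exact ⟨⟨q.1.1, q.2.1⟩, g, Subtype.ext (Prod.ext rfl hg)⟩) (fun _ _ _ => rfl) (fun _ _ _ => rfl)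
  rw [← topProd b] at h3
  -- stability of `Z`
  have hstab : ∀ M ∈ Z, ∀ N ∈ orbitSet K A M, N ∈ Z := by
    let W : Set (ModVar K A d) := {N | ∃ M ∈ Z, N ∈ orbitSet K A M}
    have hpre : ∀ f ∈ O1 (fun (M : ModVar K A d) k => M (b k)),
        pre K (fun p : ↥{p : ModVar K A d × ModVar K A d | p.1 ∈ Z ∧ p.2 ∈ orbitSet K A p.1} => p.1.2) f ∈
        OQ (fun (p : ↥{p : ModVar K A d × ModVar K A d | p.1 ∈ Z ∧ p.2 ∈ orbitSet K A p.1}) k => p.1.1 (b k))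
          (fun p k => p.1.2 (b k)) := by
      have : (O1 (fun (M : ModVar K A d) k => M (b k))).map (pre K (fun p : ↥{p : ModVar K A d × ModVar K A d | p.1 ∈ Z ∧ p.2 ∈ orbitSet K A p.1} => p.1.2)) ≤
          OQ (fun (p : ↥{p : ModVar K A d × ModVar K A d | p.1 ∈ Z ∧ p.2 ∈ orbitSet K A p.1}) k => p.1.1 (b k))
          (fun p k => p.1.2 (b k)) := by
        rw [O1, AlgHom.map_adjoin, ← Set.range_comp]
        exact Algebra.adjoin_mono Set.subset_union_right
      exact fun f hf => this ⟨f, hf, rfl⟩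
    have hZW : Z ⊆ W := fun M hM => ⟨M, hM, 1, fun a => by simp⟩
    have hW : IsIrreducible W := by
      have : (vid (O1 (fun (M : ModVar K A d) k => M (b k))) W).IsPrime := by
        constructor
        · intro h
          obtain ⟨x, hx⟩ := hZi.1
          have : (1 : O1 (fun (M : ModVar K A d) k => M (b k))) ∈ vid (O1 (fun (M : ModVar K A d) k => M (b k))) W := by
            rw [h]; trivial
          simpa using this x (hZW hx)
        · intro f g hfg
          have h0 : (⟨_, hpre f.1 f.2⟩ * ⟨_, hpre g.1 g.2⟩ : OQ (fun (p : ↥{p : ModVar K A d × ModVar K A d | p.1 ∈ Z ∧ p.2 ∈ orbitSet K A p.1}) k => p.1.1 (b k))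
            (fun p k => p.1.2 (b k))) = 0 := by
            apply Subtype.ext; funext p
            exact hfg p.1.2 ⟨p.1.1, p.2.1, p.2.2⟩
          rcases mul_eq_zero.mp h0 with h | h
          · left
            rintro N ⟨M, hM, hN⟩
            exact congrFun (congrArg Subtype.val h) ⟨(M, N), hM, hN⟩
          · right
            rintro N ⟨M, hM, hN⟩
            exact congrFun (congrArg Subtype.val h) ⟨(M, N), hM, hN⟩
      have := irred_of_vid_prime _ _ this
      rw [← topMod b] at this
      exact this
    intro M hM N hN
    exact hZ.2 hW hZW ⟨M, hM, hN⟩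
  have hset : {p : ModVar K A d × ModVar K A d | p.1 ∈ Z ∧ p.2 ∈ Z ∧ p.2 ∈ orbitSet K A p.1} =
      {p : ModVar K A d × ModVar K A d | p.1 ∈ Z ∧ p.2 ∈ orbitSet K A p.1} := by
    ext p
    exact ⟨fun h => ⟨h.1, h.2.2⟩, fun h => ⟨h.1, hstab _ h.1 _ h.2, h.2⟩⟩
  rw [hset, h3] at hdimIso
  obtain ⟨r', hr', hk⟩ := krull_eq_trdeg K (O1 ρ)
  have hrr : r' = r := by rw [h1] at hr'; exact_mod_cast hr'.symm
  subst hrr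
  have hZdim := krull_closed (O1 ρ) hpt
  rw [← htZ, hk] at hZdim
  have e1 : r' = dimZ := by
    have := hZdim.symm.trans hdimZ
    exact_mod_cast this
  have hprod := prod_dim ρ hpt (Q := ↥(Z ×ˢ Z)) (fun q => ⟨q.1.1, q.2.1⟩) (fun q => ⟨q.1.2, q.2.2⟩)
    (fun s t => ⟨⟨(s.1, t.1), s.2, t.2⟩, rfl, rfl⟩) r' hk
  have e2 : r' + r' = dimZZ := by
    have hh := topProd b (Z ×ˢ Z)
    rw [hh] at hdimZZ
    have := hprod.symm.trans hdimZZ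
    exact_mod_cast this
  have e3 : r' + Fintype.card (Fin d × Fin d) - e = dimIso := by exact_mod_cast hdimIso
  have e4 : ∀ M ∈ Z, Fintype.card (Fin d × Fin d) - Module.finrank K (hs (fun k => M (b k)) (fun k => M (b k))) = dimOrb M := by
    intro M hM
    have := (orbit_dim b M).symm.trans (hdimOrb M hM)
    exact_mod_cast this
  have e5 : ∀ M : ModVar K A d, Module.finrank K (hs (fun k => M (b k)) (fun k => M (b k))) ≤ Fintype.card (Fin d × Fin d) := by
    intro M
    refine (Submodule.finrank_le _).trans ?_
    rw [Module.finrank_matrix]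
    simp
  have h5' : e = Module.finrank K (hs (fun k => M1.1 (b k)) (fun k => M1.1 (b k))) := h5
  have key : dimZZ - dimIso = dimZ - dimOrb M1.1 := by
    have := e4 M1.1 M1.2
    have := e5 M1.1
    omega
  refine le_antisymm ?_ ?_
  · refine le_csInf ⟨_, M1.1, M1.2, rfl⟩ ?_
    rintro _ ⟨M, hM, rfl⟩
    have := e4 M hM
    have := e5 M
    have h6 : e ≤ Module.finrank K (hs (fun k => M (b k)) (fun k => M (b k))) := h4 ⟨M, hM⟩
    have := e4 M1.1 M1.2
    omega
  · rw [key]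
    exact Nat.sInf_le ⟨M1.1, M1.2, rfl⟩
end fin
end MV


/-- Let `A` be a finite-dimensional algebra over an algebraically closed field
`K` and `Z` an irreducible component of `mod(A,d)`.  Then the codimension in
`Z × Z` of the set of pairs `(M,M')` with `M ≅ M'` equals
`c(Z) = min { dim Z − dim O_M | M ∈ Z }`, the number of parameters of `Z`. -/
theorem codim_isoPairs_eq_numberOfParameters [IsAlgClosed K] [FiniteDimensional K A]
    (d : ℕ) (Z : Set (ModVar K A d)) (hZ : Z ∈ irreducibleComponents (ModVar K A d))
    (dimZ dimZZ dimIso : ℕ) (dimOrb : ModVar K A d → ℕ)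
    (hdimZ : topologicalKrullDim Z = (dimZ : WithBot ℕ∞))
    (hdimZZ : @topologicalKrullDim ↥(Z ×ˢ Z)
      (TopologicalSpace.induced Subtype.val (prodZariski K A d d)) = (dimZZ : WithBot ℕ∞))
    (hdimIso : @topologicalKrullDim
      ↥{p : ModVar K A d × ModVar K A d | p.1 ∈ Z ∧ p.2 ∈ Z ∧ p.2 ∈ orbitSet K A p.1}
      (TopologicalSpace.induced Subtype.val (prodZariski K A d d)) = (dimIso : WithBot ℕ∞))
    (hdimOrb : ∀ M ∈ Z, topologicalKrullDim (orbitSet K A M) = (dimOrb M : WithBot ℕ∞)) :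
    dimZZ - dimIso = sInf {k : ℕ | ∃ M ∈ Z, k = dimZ - dimOrb M} := by
  exact MV.main (Module.finBasis K A) Z hZ dimZ dimZZ dimIso dimOrb hdimZ hdimZZ hdimIso hdimOrb
end

section
/- Let A be a finite-dimensional algebra over an algebraically closed field K and Z an irreducible component of mod(A,d) that does not contain a dense GL_d(K)-orbit. Then the generic value hom_A(Z,Z) of (M,M') ↦ dim Hom_A(M,M') on Z × Z is strictly smaller than the generic value end_A(Z) of M ↦ dim End_A(M) on Z. -/
open TopologicalSpace Topology CategoryTheory

variable (K A : Type) [Field K] [Ring A] [Algebra K A]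

section Helpers

theorem det_mem_subalg {K X n : Type*} [Field K] [Fintype n] [DecidableEq n]
    (S : Subalgebra K (X → K)) (F : X → Matrix n n K)
    (h : ∀ i j, (fun w => F w i j) ∈ S) : (fun w => (F w).det) ∈ S := by
  have : (fun w => (F w).det) =
      ∑ σ : Equiv.Perm n, (Equiv.Perm.sign σ : ℤ) • ∏ i, (fun w => F w (σ i) i) := by
    funext w
    simp [Matrix.det_apply', Finset.sum_apply, Finset.prod_apply]
  rw [this]
  exact S.sum_mem fun σ _ => S.zsmul_mem (S.prod_mem fun i _ => h _ _) _

theorem const_mem_subalg {K X : Type*} [Field K]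
    (S : Subalgebra K (X → K)) (c : K) : (fun _ => c) ∈ S := S.algebraMap_mem c

theorem adjugate_mem_subalg {K X n : Type*} [Field K] [Fintype n] [DecidableEq n]
    (S : Subalgebra K (X → K)) (F : X → Matrix n n K)
    (h : ∀ i j, (fun w => F w i j) ∈ S) (i j : n) : (fun w => (F w).adjugate i j) ∈ S := by
  simp only [Matrix.adjugate_apply]
  apply det_mem_subalg
  intro k l
  by_cases hk : k = j
  · subst hk
    simp only [Matrix.updateRow_self]
    exact const_mem_subalg S _
  · simp only [Matrix.updateRow_ne hk]
    exact h k l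

theorem sum_mem_subalg {K X n : Type*} [Field K] [Fintype n]
    (S : Subalgebra K (X → K)) (F : n → X → K)
    (h : ∀ i, F i ∈ S) : (fun w => ∑ i, F i w) ∈ S := by
  have : (fun w => ∑ i, F i w) = ∑ i, F i := by funext w; simp
  rw [this]
  exact S.sum_mem fun i _ => h i

/-- polynomial functions -/
noncomputable def polyFun (K W : Type*) [Field K] [AddCommGroup W] [Module K W] :
    Subalgebra K (W → K) :=
  Algebra.adjoin K (Set.range fun (φ : Module.Dual K W) => (φ : W → K))

theorem zariski_basis (K W : Type*) [Field K] [AddCommGroup W] [Module K W] :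
    @TopologicalSpace.IsTopologicalBasis W (zariskiTopology K W)
      {U | ∃ f ∈ polyFun K W, U = {w | f w ≠ 0}} := by
  letI := zariskiTopology K W
  refine ⟨?_, ?_, ?_⟩
  · rintro _ ⟨f, hf, rfl⟩ _ ⟨g, hg, rfl⟩ x ⟨hx, hx'⟩
    refine ⟨_, ⟨f * g, Subalgebra.mul_mem _ hf hg, rfl⟩, ?_, ?_⟩
    · exact mul_ne_zero hx hx'
    · intro y hy
      exact ⟨left_ne_zero_of_mul hy, right_ne_zero_of_mul hy⟩
  · refine Set.eq_univ_of_forall fun x => ?_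
    exact ⟨_, ⟨1, Subalgebra.one_mem _, rfl⟩, by simp⟩
  · apply le_antisymm
    · rw [le_generateFrom_iff_subset_isOpen]
      rintro _ ⟨f, hf, rfl⟩
      have h1 : zariskiTopology K W ≤ TopologicalSpace.induced
          (fun w => CofiniteTopology.of (f w)) inferInstance := iInf₂_le f hf
      apply h1
      refine ⟨{CofiniteTopology.of 0}ᶜ, ?_, ?_⟩
      · rw [isOpen_compl_iff, CofiniteTopology.isClosed_iff]
        right; simp
      · ext w; simp
    · refine le_iInf₂ fun f hf => ?_
      letI t := TopologicalSpace.generateFrom {U | ∃ f ∈ polyFun K W, U = {w | f w ≠ 0}}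
      rintro _ ⟨V, hV, rfl⟩
      rcases Set.eq_empty_or_nonempty V with rfl | hne
      · simp
      have hfin := CofiniteTopology.isOpen_iff'.1 hV
      replace hfin := hfin.resolve_left hne.ne_empty
      apply TopologicalSpace.isOpen_generateFrom_of_mem
      refine ⟨∏ c ∈ hfin.toFinset, (f - algebraMap K (W → K) (CofiniteTopology.of.symm c)), ?_, ?_⟩
      · exact Subalgebra.prod_mem _ fun c _ => Subalgebra.sub_mem _ hf (Subalgebra.algebraMap_mem _ _)
      · ext w
        simp only [Set.mem_preimage, Finset.prod_apply, Pi.sub_apply, Pi.algebraMap_apply,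
          Algebra.algebraMap_self, RingHom.id_apply, Set.mem_setOf_eq, Finset.prod_ne_zero_iff,
          Set.Finite.mem_toFinset, Set.mem_compl_iff, sub_ne_zero]
        constructor
        · intro h c hc he
          apply hc
          rw [he] at h
          simpa using h
        · intro h
          by_contra hc
          exact h _ hc (by simp)

theorem modVar_basis (K A : Type) [Field K] [Ring A] [Algebra K A] (d : ℕ) :
    TopologicalSpace.IsTopologicalBasis
      {U : Set (ModVar K A d) | ∃ f ∈ polyFun K (A →ₗ[K] Matrix (Fin d) (Fin d) K),
        U = {M | f M.toLinearMap ≠ 0}} := by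
  letI := zariskiTopology K (A →ₗ[K] Matrix (Fin d) (Fin d) K)
  have := (zariski_basis K (A →ₗ[K] Matrix (Fin d) (Fin d) K)).induced
    (fun M : ModVar K A d => M.toLinearMap)
  suffices he : {U : Set (ModVar K A d) | ∃ f ∈ polyFun K (A →ₗ[K] Matrix (Fin d) (Fin d) K),
        U = {M | f M.toLinearMap ≠ 0}} = (Set.preimage fun M => AlgHom.toLinearMap M) ''
      {U | ∃ f ∈ polyFun K (A →ₗ[K] Matrix (Fin d) (Fin d) K), U = {w | f w ≠ 0}} by
    rw [he]; exact this
  ext U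
  constructor
  · rintro ⟨f, hf, rfl⟩
    exact ⟨_, ⟨f, hf, rfl⟩, rfl⟩
  · rintro ⟨_, ⟨f, hf, rfl⟩, rfl⟩
    exact ⟨f, hf, rfl⟩

/-- polynomial functions on matrices -/
noncomputable def matPoly (K : Type) [Field K] (d : ℕ) :
    Subalgebra K (Matrix (Fin d) (Fin d) K → K) :=
  (MvPolynomial.aeval (R := K) (fun (ij : Fin d × Fin d) (g : Matrix (Fin d) (Fin d) K) =>
    g ij.1 ij.2)).range

theorem matPoly_mul_ne (K : Type) [Field K] [Infinite K] (d : ℕ)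
    {p q : Matrix (Fin d) (Fin d) K → K} (hp : p ∈ matPoly K d) (hq : q ∈ matPoly K d)
    (hp0 : ∃ g, p g ≠ 0) (hq0 : ∃ g, q g ≠ 0) : ∃ g, p g * q g ≠ 0 := by
  obtain ⟨P, rfl⟩ := hp
  obtain ⟨Q, rfl⟩ := hq
  by_contra! hcon
  have key : ∀ (P : MvPolynomial (Fin d × Fin d) K) (g : Matrix (Fin d) (Fin d) K),
      (MvPolynomial.aeval (R := K) (fun (ij : Fin d × Fin d) (g : Matrix (Fin d) (Fin d) K) =>
    g ij.1 ij.2)) P g = MvPolynomial.eval (fun ij => g ij.1 ij.2) P := by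
    intro P g
    induction P using MvPolynomial.induction_on with
    | C a => simp
    | add p q hp hq => simp [hp, hq]
    | mul_X p n hp => simp [hp]
  have h0 : P * Q = 0 := by
    apply MvPolynomial.funext
    intro x
    have := hcon (Matrix.of fun i j => x (i, j))
    erw [key, key] at this
    simpa using this
  rcases mul_eq_zero.1 h0 with rfl | rfl
  · obtain ⟨g, hg⟩ := hp0; simp at hg
  · obtain ⟨g, hg⟩ := hq0; simp at hg

theorem matPoly_entry (K : Type) [Field K] (d : ℕ) (i j : Fin d) :
    (fun g : Matrix (Fin d) (Fin d) K => g i j) ∈ matPoly K d :=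
  ⟨MvPolynomial.X (i, j), by simp⟩

theorem dual_expand (K A : Type) [Field K] [Ring A] [Algebra K A] [FiniteDimensional K A] (d : ℕ)
    (φ : Module.Dual K (A →ₗ[K] Matrix (Fin d) (Fin d) K)) :
    ∃ c : Fin (Module.finrank K A) → Fin d → Fin d → K, ∀ w, φ w =
      ∑ k, ∑ i, ∑ j, c k i j * w (Module.finBasis K A k) i j := by
  let b := Module.finBasis K A
  refine ⟨fun k i j => φ ((b.coord k).smulRight (Matrix.single i j 1)), fun w => ?_⟩
  have : w = ∑ k, ∑ i, ∑ j, (w (b k) i j) • ((b.coord k).smulRight (Matrix.single i j (1:K))) := by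
    apply b.ext
    intro l
    simp only [LinearMap.sum_apply, LinearMap.smul_apply, LinearMap.smulRight_apply,
      Module.Basis.coord_apply, Module.Basis.repr_self]
    rw [Finset.sum_eq_single l]
    · simp only [Finsupp.single_eq_same, one_smul]
      conv_lhs => rw [Matrix.matrix_eq_sum_single (w (b l))]
      simp [Matrix.smul_single]
    · intro k _ hk
      simp [Finsupp.single_apply, hk.symm]
    · simp
  conv_lhs => rw [this]
  simp [map_sum, mul_comm, b]

/-- the orbit map, as linear maps -/
noncomputable def orbMap (K A : Type) [Field K] [Ring A] [Algebra K A] {d : ℕ} (M : ModVar K A d)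
    (g : (Matrix (Fin d) (Fin d) K)ˣ) : ModVar K A d :=
  (MulSemiringAction.toAlgEquiv K (Matrix (Fin d) (Fin d) K) (ConjAct.toConjAct g⁻¹)).toAlgHom.comp M

theorem orbMap_apply (K A : Type) [Field K] [Ring A] [Algebra K A] {d : ℕ} (M : ModVar K A d)
    (g : (Matrix (Fin d) (Fin d) K)ˣ) (a : A) : orbMap K A M g a =
    (↑g⁻¹ : Matrix (Fin d) (Fin d) K) * M a * (↑g : Matrix (Fin d) (Fin d) K) := by
  simp [orbMap, ConjAct.units_smul_def]

theorem pull_poly (K A : Type) [Field K] [Ring A] [Algebra K A] [FiniteDimensional K A] {d : ℕ}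
    (M : ModVar K A d) (f : (A →ₗ[K] Matrix (Fin d) (Fin d) K) → K)
    (hf : f ∈ polyFun K (A →ₗ[K] Matrix (Fin d) (Fin d) K)) :
    ∃ n : ℕ, ∃ p ∈ matPoly K d, ∀ g : (Matrix (Fin d) (Fin d) K)ˣ,
      p g = (g : Matrix (Fin d) (Fin d) K).det ^ n * f (orbMap K A M g).toLinearMap := by
  have hdet : (fun g : Matrix (Fin d) (Fin d) K => g.det) ∈ matPoly K d :=
    det_mem_subalg _ _ (matPoly_entry K d)
  induction hf using Algebra.adjoin_induction with
  | mem x hx =>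
    obtain ⟨φ, rfl⟩ := hx
    obtain ⟨c, hc⟩ := dual_expand K A d φ
    refine ⟨1, fun g => ∑ k, ∑ i, ∑ j, c k i j *
      (g.adjugate * M (Module.finBasis K A k) * g) i j, ?_, ?_⟩
    · refine sum_mem_subalg _ _ fun k => sum_mem_subalg _ _ fun i => sum_mem_subalg _ _ fun j => ?_
      refine Subalgebra.mul_mem _ (const_mem_subalg _ _) ?_
      simp only [Matrix.mul_apply]
      refine sum_mem_subalg _ _ fun l => ?_
      refine Subalgebra.mul_mem _ (sum_mem_subalg _ _ fun m => ?_) (matPoly_entry K d _ _)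
      exact Subalgebra.mul_mem _ (adjugate_mem_subalg _ _ (matPoly_entry K d) _ _)
        (const_mem_subalg _ _)
    · intro g
      have hg : (g : Matrix (Fin d) (Fin d) K).adjugate =
          (g : Matrix (Fin d) (Fin d) K).det • (↑g⁻¹ : Matrix (Fin d) (Fin d) K) := by
        have h := Matrix.adjugate_mul (g : Matrix (Fin d) (Fin d) K)
        calc _ = (g : Matrix (Fin d) (Fin d) K).adjugate * (g * (↑g⁻¹ : Matrix (Fin d) (Fin d) K)) := by
              simp
          _ = _ := by rw [← mul_assoc, h]; simp
      simp only [hc, AlgHom.toLinearMap_apply, orbMap_apply, hg, Finset.mul_sum, pow_one]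
      refine Finset.sum_congr rfl fun k _ => Finset.sum_congr rfl fun i _ =>
        Finset.sum_congr rfl fun j _ => ?_
      simp only [Matrix.smul_mul, Matrix.smul_apply, smul_eq_mul]
      ring
  | algebraMap r =>
    exact ⟨0, fun _ => r, const_mem_subalg _ _, fun g => by simp⟩
  | add x y _ _ hx hy =>
    obtain ⟨n, p, hp, hpe⟩ := hx
    obtain ⟨m, q, hq, hqe⟩ := hy
    refine ⟨n + m, (fun g => g.det) ^ m * p + (fun g => g.det) ^ n * q,
      Subalgebra.add_mem _ (Subalgebra.mul_mem _ (Subalgebra.pow_mem _ hdet _) hp)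
        (Subalgebra.mul_mem _ (Subalgebra.pow_mem _ hdet _) hq), fun g => ?_⟩
    simp only [Pi.add_apply, Pi.mul_apply, Pi.pow_apply, hpe, hqe]
    ring
  | mul x y _ _ hx hy =>
    obtain ⟨n, p, hp, hpe⟩ := hx
    obtain ⟨m, q, hq, hqe⟩ := hy
    refine ⟨n + m, p * q, Subalgebra.mul_mem _ hp hq, fun g => ?_⟩
    simp only [Pi.mul_apply, hpe, hqe]
    ring

theorem orbit_irreducible (K A : Type) [Field K] [Ring A] [Algebra K A] [Infinite K]
    [FiniteDimensional K A] {d : ℕ} (M : ModVar K A d) : IsIrreducible (orbitSet K A M) := by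
  refine ⟨⟨M, 1, by simp⟩, ?_⟩
  have hdet : (fun g : Matrix (Fin d) (Fin d) K => g.det) ∈ matPoly K d :=
    det_mem_subalg _ _ (matPoly_entry K d)
  rintro U V hU hV ⟨x, ⟨g₁, hx⟩, hxU⟩ ⟨y, ⟨g₂, hy⟩, hyV⟩
  obtain ⟨_, ⟨f₁, hf₁, rfl⟩, hx1, hsub1⟩ := (modVar_basis K A d).exists_subset_of_mem_open hxU hU
  obtain ⟨_, ⟨f₂, hf₂, rfl⟩, hx2, hsub2⟩ := (modVar_basis K A d).exists_subset_of_mem_open hyV hV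
  have ex : x = orbMap K A M g₁ := AlgHom.ext fun a => by rw [hx, orbMap_apply]
  have ey : y = orbMap K A M g₂ := AlgHom.ext fun a => by rw [hy, orbMap_apply]
  subst ex ey
  obtain ⟨n, p, hp, hpe⟩ := pull_poly K A M f₁ hf₁
  obtain ⟨m, q, hq, hqe⟩ := pull_poly K A M f₂ hf₂
  have hu : ∀ g : (Matrix (Fin d) (Fin d) K)ˣ, (g : Matrix (Fin d) (Fin d) K).det ≠ 0 := fun g =>
    ((Matrix.isUnit_iff_isUnit_det _).1 g.isUnit).ne_zero
  obtain ⟨g₀, hg₀⟩ := matPoly_mul_ne K d hp hq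
    ⟨g₁, by rw [hpe]; exact mul_ne_zero (pow_ne_zero _ (hu _)) hx1⟩
    ⟨g₂, by rw [hqe]; exact mul_ne_zero (pow_ne_zero _ (hu _)) hx2⟩
  obtain ⟨g, hg⟩ := matPoly_mul_ne K d (Subalgebra.mul_mem _ hp hq) hdet ⟨g₀, hg₀⟩ ⟨1, by simp⟩
  have hgd : g.det ≠ 0 := right_ne_zero_of_mul hg
  have hgu : IsUnit g := (Matrix.isUnit_iff_isUnit_det _).2 hgd.isUnit
  obtain ⟨g, rfl⟩ := hgu
  have hpq : p g * q g ≠ 0 := left_ne_zero_of_mul hg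
  rw [hpe, hqe] at hpq
  refine ⟨orbMap K A M g, ⟨g, orbMap_apply K A M g⟩, hsub1 ?_, hsub2 ?_⟩
  · exact right_ne_zero_of_mul (left_ne_zero_of_mul hpq)
  · exact right_ne_zero_of_mul (right_ne_zero_of_mul hpq)

/-- The intertwiner defect, linear in the target structure. -/
noncomputable def defect (K A : Type) [Field K] [Ring A] [Algebra K A] {d : ℕ}
    (M : A →ₗ[K] Matrix (Fin d) (Fin d) K) :
    (Matrix (Fin d) (Fin d) K) →ₗ[K] (A →ₗ[K] Matrix (Fin d) (Fin d) K) :=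
  LinearMap.mk₂ K (fun F a => F * M a) (by intros; simp [add_mul]) (by intros; simp)
    (by intros; simp [mul_add]) (by intros; simp)

/-- left multiplication part -/
noncomputable def defect' (K A : Type) [Field K] [Ring A] [Algebra K A] {d : ℕ} :
    (A →ₗ[K] Matrix (Fin d) (Fin d) K) →ₗ[K]
    (Matrix (Fin d) (Fin d) K) →ₗ[K] (A →ₗ[K] Matrix (Fin d) (Fin d) K) :=
  LinearMap.mk₂ K (fun w F => (LinearMap.mulRight K F).comp w)
    (by intros; ext; simp [add_mul]) (by intros; ext; simp)
    (by intros; ext; simp [mul_add]) (by intros; ext; simp)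

theorem finrank_ker (K A : Type) [Field K] [Ring A] [Algebra K A] {d : ℕ} (M M' : ModVar K A d) :
    Module.finrank K (LinearMap.ker (defect K A M.toLinearMap - defect' K A M'.toLinearMap)) =
      Module.finrank K (homSpace K A M M') := by
  have : homSpace K A M M' = (LinearMap.ker (defect K A M.toLinearMap - defect' K A M'.toLinearMap)).map
      (Matrix.toLin' : Matrix (Fin d) (Fin d) K ≃ₗ[K] _).toLinearMap := by
    ext f
    obtain ⟨F, rfl⟩ := (Matrix.toLin' : Matrix (Fin d) (Fin d) K ≃ₗ[K] _).surjective f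
    rw [Submodule.mem_map]
    have h1 : Matrix.toLin' F ∈ homSpace K A M M' ↔ ∀ a, F * M a = M' a * F := by
      refine forall_congr' fun a => ?_
      rw [← Matrix.toLin'_apply', ← Matrix.toLin'_apply', ← Matrix.toLin'_mul, ← Matrix.toLin'_mul]
      exact Matrix.toLin'.injective.eq_iff
    have h2 : F ∈ LinearMap.ker (defect K A M.toLinearMap - defect' K A M'.toLinearMap) ↔
        ∀ a, F * M a = M' a * F := by
      rw [LinearMap.mem_ker, LinearMap.ext_iff]
      refine forall_congr' fun a => ?_
      simp [defect, defect', sub_eq_zero]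
    rw [h1, ← h2]
    constructor
    · intro h; exact ⟨F, h, rfl⟩
    · rintro ⟨G, hG, hGF⟩
      rwa [← Matrix.toLin'.injective hGF]
  rw [this]
  exact (LinearEquiv.finrank_map_eq _ _).symm

theorem exists_retract {K V T : Type*} [Field K] [AddCommGroup V] [Module K V] [AddCommGroup T]
    [Module K T] (L : V →ₗ[K] T) : ∃ (P : T →ₗ[K] V) (π : V →ₗ[K] V),
      LinearMap.range π ≤ LinearMap.ker L ∧ P ∘ₗ L + π = LinearMap.id := by
  obtain ⟨r, hr⟩ := L.rangeRestrict.exists_rightInverse_of_surjective L.range_rangeRestrict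
  obtain ⟨P, hP⟩ := r.exists_extend
  have hPL : ∀ v, P (L v) = r (L.rangeRestrict v) := fun v => by
    rw [← hP]; rfl
  have hLr : ∀ y, L (r y) = y := fun y => by
    have := LinearMap.congr_fun hr y
    exact congrArg Subtype.val this
  refine ⟨P, LinearMap.id - P ∘ₗ L, ?_, by simp⟩
  rintro _ ⟨v, rfl⟩
  simp [hPL, hLr]

theorem lift_id {K V T : Type*} [Field K] [AddCommGroup V] [Module K V] [AddCommGroup T]
    [Module K T] [FiniteDimensional K V] (L L' : V →ₗ[K] T) (P : T →ₗ[K] V) (π : V →ₗ[K] V)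
    (hπ : LinearMap.range π ≤ LinearMap.ker L)
    (hfr : Module.finrank K (LinearMap.ker L) ≤ Module.finrank K (LinearMap.ker L'))
    (hinj : Function.Injective (P ∘ₗ L' + π)) (v : V) (hv : (P ∘ₗ L' + π) v ∈ LinearMap.ker L) :
    v ∈ LinearMap.ker L' := by
  have hle : (LinearMap.ker L').map (P ∘ₗ L' + π) ≤ LinearMap.ker L := by
    rintro _ ⟨x, hx, rfl⟩
    have : (P ∘ₗ L' + π) x = π x := by simp [LinearMap.mem_ker.1 hx]
    rw [this]
    exact hπ ⟨x, rfl⟩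
  have heq := Submodule.eq_of_le_of_finrank_le hle
    (by rwa [← (Submodule.equivMapOfInjective _ hinj (LinearMap.ker L')).finrank_eq])
  rw [← heq] at hv
  obtain ⟨x, hx, hxv⟩ := hv
  rwa [← hinj hxv]

theorem local_orbit (K A : Type) [Field K] [Ring A] [Algebra K A] {d : ℕ} (M : ModVar K A d) :
    ∃ U : Set (ModVar K A d), IsOpen U ∧ M ∈ U ∧ ∀ M' ∈ U,
      Module.finrank K (homSpace K A M M) ≤ Module.finrank K (homSpace K A M M') →
      M' ∈ orbitSet K A M := by
  let L : (A →ₗ[K] Matrix (Fin d) (Fin d) K) →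
    (Matrix (Fin d) (Fin d) K) →ₗ[K] (A →ₗ[K] Matrix (Fin d) (Fin d) K) := fun w =>
    defect K A M.toLinearMap - defect' K A w
  obtain ⟨P, π, hπ, hid⟩ := exists_retract (L M.toLinearMap)
  let β := Matrix.stdBasis K (Fin d) (Fin d)
  let Q : (A →ₗ[K] Matrix (Fin d) (Fin d) K) → Matrix (Fin d × Fin d) (Fin d × Fin d) K := fun w =>
    LinearMap.toMatrix β β (P ∘ₗ L w + π)
  let F : (A →ₗ[K] Matrix (Fin d) (Fin d) K) → Matrix (Fin d) (Fin d) K := fun w =>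
    Matrix.toLin β β (Q w).adjugate 1
  have hQ : ∀ i j, (fun w => Q w i j) ∈ polyFun K (A →ₗ[K] Matrix (Fin d) (Fin d) K) := by
    intro i j
    let φ : Module.Dual K (A →ₗ[K] Matrix (Fin d) (Fin d) K) :=
      (β.coord i) ∘ₗ P ∘ₗ ((defect' K A).flip (β j))
    have : (fun w => Q w i j) = (fun _ => β.repr (P (defect K A M.toLinearMap (β j)) + π (β j)) i)
        - (φ : _ → K) := by
      funext w
      simp only [Q, L]
      rw [LinearMap.toMatrix_apply]
      simp only [φ, LinearMap.add_apply, LinearMap.comp_apply,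
        LinearMap.sub_apply, map_sub, map_add, Pi.sub_apply, LinearMap.flip_apply,
        Module.Basis.coord_apply, Finsupp.add_apply, Finsupp.sub_apply]
      ring
    rw [this]
    exact Subalgebra.sub_mem _ (const_mem_subalg _ _) (Algebra.subset_adjoin ⟨φ, rfl⟩)
  have hF : ∀ i j, (fun w => F w i j) ∈ polyFun K (A →ₗ[K] Matrix (Fin d) (Fin d) K) := by
    intro i j
    have : (fun w => F w i j) = fun w => ∑ l, ∑ k, ((Q w).adjugate l k * β.repr 1 k) * β l i j := by
      funext w
      simp only [F, Matrix.toLin_apply, Matrix.mulVec, dotProduct, Matrix.sum_apply,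
        Matrix.smul_apply, smul_eq_mul, Finset.sum_mul]
    rw [this]
    refine sum_mem_subalg _ _ fun l => sum_mem_subalg _ _ fun k => ?_
    exact Subalgebra.mul_mem _ (Subalgebra.mul_mem _ (adjugate_mem_subalg _ _ hQ _ _)
      (const_mem_subalg _ _)) (const_mem_subalg _ _)
  have hQM : Q M.toLinearMap = 1 := by
    simp only [Q, hid, LinearMap.toMatrix_id]
  refine ⟨{M' | (Q M'.toLinearMap).det * (F M'.toLinearMap).det ≠ 0},
    (modVar_basis K A d).isOpen ⟨_, Subalgebra.mul_mem _ (det_mem_subalg _ _ hQ)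
      (det_mem_subalg _ _ hF), rfl⟩, ?_, ?_⟩
  · simp [F, hQM]
  · intro M' hM' hle
    have hQd : (Q M'.toLinearMap).det ≠ 0 := left_ne_zero_of_mul hM'
    have hFd : (F M'.toLinearMap).det ≠ 0 := right_ne_zero_of_mul hM'
    have e1 : Matrix.toLin β β (Q M'.toLinearMap) = P ∘ₗ L M'.toLinearMap + π :=
      Matrix.toLin_toMatrix _ _ _
    have hinj : Function.Injective (P ∘ₗ L M'.toLinearMap + π) := by
      rw [← e1]
      have h3 : Matrix.toLin β β (Q M'.toLinearMap).adjugate ∘ₗ Matrix.toLin β β (Q M'.toLinearMap)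
          = (Q M'.toLinearMap).det • LinearMap.id := by
        rw [← Matrix.toLin_mul, Matrix.adjugate_mul, map_smul, Matrix.toLin_one]
      intro x y hxy
      have hx := LinearMap.congr_fun h3 x
      have hy := LinearMap.congr_fun h3 y
      simp only [LinearMap.comp_apply, hxy, LinearMap.smul_apply, LinearMap.id_apply] at hx hy
      exact smul_right_injective _ hQd (hx.symm.trans hy)
    have hmem : (P ∘ₗ L M'.toLinearMap + π) (F M'.toLinearMap) ∈ LinearMap.ker (L M.toLinearMap) := by
      have h4 : (P ∘ₗ L M'.toLinearMap + π) (F M'.toLinearMap) = (Q M'.toLinearMap).det • 1 := by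
        rw [← e1]
        simp only [F]
        rw [← LinearMap.comp_apply, ← Matrix.toLin_mul, Matrix.mul_adjugate, map_smul,
          Matrix.toLin_one]
        rfl
      rw [h4]
      apply Submodule.smul_mem
      rw [LinearMap.mem_ker]
      ext1 a
      simp [L, defect, defect']
    have hk := lift_id (L M.toLinearMap) (L M'.toLinearMap) P π hπ
      (by simp only [L, finrank_ker]; exact hle) hinj _ hmem
    have hcomm : ∀ a, F M'.toLinearMap * M a = M' a * F M'.toLinearMap := by
      intro a
      have := LinearMap.congr_fun (LinearMap.mem_ker.1 hk) a
      simpa [L, defect, defect', sub_eq_zero] using this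
    obtain ⟨u, hu⟩ := (Matrix.isUnit_iff_isUnit_det _).2 hFd.isUnit
    refine ⟨u⁻¹, fun a => ?_⟩
    rw [inv_inv, hu, hcomm a, ← hu, mul_assoc, Units.mul_inv, mul_one]

end Helpers

/-- Let `A` be a finite-dimensional algebra over an algebraically closed field
`K` and `Z` an irreducible component of `mod(A,d)` that does not contain a
dense `GL_d(K)`-orbit.  Then the generic (i.e. minimal) value of
`(M,M') ↦ dim Hom_A(M,M')` on `Z × Z` is strictly smaller than the generic
(minimal) value of `M ↦ dim End_A(M)` on `Z`. -/
theorem hom_lt_end_of_no_dense_orbit [IsAlgClosed K] [FiniteDimensional K A]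
    (d : ℕ) (Z : Set (ModVar K A d)) (hZ : Z ∈ irreducibleComponents (ModVar K A d))
    (hnodense : ¬ ∃ M ∈ Z, closure (orbitSet K A M) = Z) :
    sInf {k : ℕ | ∃ M ∈ Z, ∃ M' ∈ Z, k = Module.finrank K (homSpace K A M M')} <
      sInf {k : ℕ | ∃ M ∈ Z, k = Module.finrank K (homSpace K A M M)} := by
  by_contra hcon
  rw [not_lt] at hcon
  have : Infinite K := IsAlgClosed.instInfinite
  obtain ⟨hZirr, hZmax⟩ := hZ
  obtain ⟨M₀, hM₀⟩ := hZirr.1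
  obtain ⟨M, hM, hMe⟩ := Nat.sInf_mem
    (s := {k : ℕ | ∃ M ∈ Z, k = Module.finrank K (homSpace K A M M)}) ⟨_, M₀, hM₀, rfl⟩
  obtain ⟨U, hU, hMU, hUorb⟩ := local_orbit K A M
  have hsub : Z ⊆ closure (orbitSet K A M) := by
    intro x hx
    rw [mem_closure_iff]
    intro V hV hxV
    obtain ⟨y, hyZ, hyV, hyU⟩ := hZirr.2 V U hV hU ⟨x, hx, hxV⟩ ⟨M, hM, hMU⟩
    refine ⟨y, hyV, hUorb y hyU ?_⟩
    rw [← hMe]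
    exact hcon.trans (Nat.sInf_le ⟨M, hM, y, hyZ, rfl⟩)
  exact hnodense ⟨M, hM, le_antisymm (hZmax (orbit_irreducible K A M).closure hsub) hsub⟩
end
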